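/- Let Φ be a norm on ℝ^{n+1}, Ω̂ ⊆ ℝ^n an open set, and u ∈ BV_loc(Ω̂). If the subgraph sg(u) is a minimizer of P_Φ in Ω̂ × ℝ, then u is a minimizer of G_{Φ^o} in Ω̂. -/

import Mathlib

open MeasureTheory Set Filter

noncomputable section

/-- `ℝ^n` with the Euclidean norm. -/
abbrev Rn (n : ℕ) := EuclideanSpace ℝ (Fin n)

/-- `ℝ^{n+1} = ℝ^n × ℝ`. -/
abbrev Rn1 (n : ℕ) := Rn n × ℝ

/-- Euclidean dot product on `ℝ^n`. -/
def dotn {n : ℕ} (x y : Rn n) : ℝ := ∑ i, x i * y i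

/-- Euclidean dot product on `ℝ^{n+1} = ℝ^n × ℝ`. -/
def dotp {n : ℕ} (x y : Rn1 n) : ℝ := dotn x.1 y.1 + x.2 * y.2

/-- Euclidean norm on `ℝ^{n+1} = ℝ^n × ℝ`. -/
def enorm1 {n : ℕ} (x : Rn1 n) : ℝ := Real.sqrt (dotp x x)

/-- `Ψ` is a norm on `ℝ^n`: convex, absolutely one-homogeneous and bounded
below by a positive multiple of the Euclidean norm. -/
def IsNormN {n : ℕ} (Ψ : Rn n → ℝ) : Prop :=
  ConvexOn ℝ univ Ψ ∧ (∀ (c : ℝ) (ξ : Rn n), Ψ (c • ξ) = |c| * Ψ ξ) ∧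
    ∃ c > (0:ℝ), ∀ ξ, c * ‖ξ‖ ≤ Ψ ξ

/-- `Φ` is a norm on `ℝ^{n+1}`. -/
def IsNorm1 {n : ℕ} (Φ : Rn1 n → ℝ) : Prop :=
  ConvexOn ℝ univ Φ ∧ (∀ (c : ℝ) (ξ : Rn1 n), Φ (c • ξ) = |c| * Φ ξ) ∧
    ∃ c > (0:ℝ), ∀ ξ, c * enorm1 ξ ≤ Φ ξ

/-- Dual norm on `ℝ^n`: `Ψ^o(ξ*) = sup {ξ*·ξ : Ψ(ξ) ≤ 1}`. -/
def dualN {n : ℕ} (Ψ : Rn n → ℝ) (xs : Rn n) : ℝ :=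
  sSup ((fun ξ => dotn xs ξ) '' {ξ | Ψ ξ ≤ 1})

/-- Dual norm on `ℝ^{n+1}`. -/
def dual1 {n : ℕ} (Φ : Rn1 n → ℝ) (xs : Rn1 n) : ℝ :=
  sSup ((fun ξ => dotp xs ξ) '' {ξ | Φ ξ ≤ 1})

/-- `Φ` is cylindrical over `φ`: `Φ(ξ̂,ξ_{n+1}) = max (φ(ξ̂), |ξ_{n+1}|)`. -/
def Cylindrical {n : ℕ} (Φ : Rn1 n → ℝ) (φ : Rn n → ℝ) : Prop :=
  ∀ ξ : Rn1 n, Φ ξ = max (φ ξ.1) |ξ.2|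

/-- `A` is an open set compactly contained in `O`. -/
def CpCtd {E : Type*} [TopologicalSpace E] (A O : Set E) : Prop :=
  IsOpen A ∧ IsCompact (closure A) ∧ closure A ⊆ O

/-- Divergence of a vector field on `ℝ^n`. -/
def divN {n : ℕ} (η : Rn n → Rn n) (x : Rn n) : ℝ :=
  ∑ i, fderiv ℝ η x (EuclideanSpace.single i (1:ℝ)) i

/-- Divergence of a vector field on `ℝ^{n+1} = ℝ^n × ℝ`. -/
def div1 {n : ℕ} (η : Rn1 n → Rn1 n) (z : Rn1 n) : ℝ :=
  (∑ i, (fderiv ℝ η z (EuclideanSpace.single i (1:ℝ), (0:ℝ))).1 i) +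
    (fderiv ℝ η z ((0 : Rn n), (1:ℝ))).2

/-- Admissible test vector fields on `ℝ^n`: `C^1`, compactly supported in `A`,
with values in the unit ball of `Ψ`. -/
def TestN {n : ℕ} (A : Set (Rn n)) (Ψ : Rn n → ℝ) (η : Rn n → Rn n) : Prop :=
  ContDiff ℝ 1 η ∧ HasCompactSupport η ∧ tsupport η ⊆ A ∧ ∀ x, Ψ (η x) ≤ 1

/-- Admissible test vector fields on `ℝ^{n+1}`. -/
def Test1 {n : ℕ} (A : Set (Rn1 n)) (Φ : Rn1 n → ℝ) (η : Rn1 n → Rn1 n) : Prop :=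
  ContDiff ℝ 1 η ∧ HasCompactSupport η ∧ tsupport η ⊆ A ∧ ∀ z, Φ (η z) ≤ 1

/-- The set of numbers whose supremum is the anisotropic perimeter `P_Ψ(E,A)` in `ℝ^n`. -/
def perSetN {n : ℕ} (Ψ : Rn n → ℝ) (E A : Set (Rn n)) : Set ℝ :=
  {r | ∃ η, TestN A Ψ η ∧ r = -∫ x in E, divN η x}

/-- Anisotropic perimeter `P_Ψ(E,A)` in `ℝ^n`. -/
def PerN {n : ℕ} (Ψ : Rn n → ℝ) (E A : Set (Rn n)) : ℝ := sSup (perSetN Ψ E A)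

/-- `E` has locally finite perimeter in `O ⊆ ℝ^n`. -/
def BVlocSetN {n : ℕ} (O E : Set (Rn n)) : Prop :=
  ∀ A, CpCtd A O → BddAbove (perSetN (fun x => ‖x‖) E A)

/-- `E` is a minimizer of `P_Ψ` (by compact perturbations) in `O ⊆ ℝ^n`. -/
def MinPerN {n : ℕ} (Ψ : Rn n → ℝ) (O E : Set (Rn n)) : Prop :=
  BVlocSetN O E ∧ ∀ A, CpCtd A O → ∀ F, BVlocSetN O F →
    IsCompact (closure (symmDiff E F)) → closure (symmDiff E F) ⊆ A →
      PerN Ψ E A ≤ PerN Ψ F A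

/-- The set of numbers whose supremum is the anisotropic perimeter `P_Φ(E,A)` in `ℝ^{n+1}`. -/
def perSet1 {n : ℕ} (Φ : Rn1 n → ℝ) (E A : Set (Rn1 n)) : Set ℝ :=
  {r | ∃ η, Test1 A Φ η ∧ r = -∫ z in E, div1 η z}

/-- Anisotropic perimeter `P_Φ(E,A)` in `ℝ^{n+1}`. -/
def Per1 {n : ℕ} (Φ : Rn1 n → ℝ) (E A : Set (Rn1 n)) : ℝ := sSup (perSet1 Φ E A)

/-- `E` has locally finite perimeter in `O ⊆ ℝ^{n+1}`. -/
def BVlocSet1 {n : ℕ} (O E : Set (Rn1 n)) : Prop :=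
  ∀ A, CpCtd A O → BddAbove (perSet1 enorm1 E A)

/-- `E` is a minimizer of `P_Φ` (by compact perturbations) in `O ⊆ ℝ^{n+1}`. -/
def MinPer1 {n : ℕ} (Φ : Rn1 n → ℝ) (O E : Set (Rn1 n)) : Prop :=
  BVlocSet1 O E ∧ ∀ A, CpCtd A O → ∀ F, BVlocSet1 O F →
    IsCompact (closure (symmDiff E F)) → closure (symmDiff E F) ⊆ A →
      Per1 Φ E A ≤ Per1 Φ F A

/-- The set of numbers whose supremum is the total variation `TV(u,A)`. -/
def varSet {n : ℕ} (A : Set (Rn n)) (u : Rn n → ℝ) : Set ℝ :=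
  {r | ∃ η, TestN A (fun x => ‖x‖) η ∧ r = ∫ x in A, u x * divN η x}

/-- Total variation `TV(u,A)`. -/
def TV {n : ℕ} (u : Rn n → ℝ) (A : Set (Rn n)) : ℝ := sSup (varSet A u)

/-- `u ∈ BV_loc(Ω̂)`. -/
def BVlocFun {n : ℕ} (Ω : Set (Rn n)) (u : Rn n → ℝ) : Prop :=
  (∀ A, CpCtd A Ω → IntegrableOn u A) ∧ ∀ A, CpCtd A Ω → BddAbove (varSet A u)

/-- The set of numbers whose supremum is `G_{Φ^o}(u,A)`. -/
def Gset {n : ℕ} (Φ : Rn1 n → ℝ) (A : Set (Rn n)) (u : Rn n → ℝ) : Set ℝ :=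
  {r | ∃ η : Rn n → Rn1 n, ContDiff ℝ 1 η ∧ HasCompactSupport η ∧ tsupport η ⊆ A ∧
    (∀ x, Φ (η x) ≤ 1) ∧ r = ∫ x in A, (u x * divN (fun y => (η y).1) x + (η x).2)}

/-- The functional `G_{Φ^o}(u,A)`. -/
def Gfun {n : ℕ} (Φ : Rn1 n → ℝ) (u : Rn n → ℝ) (A : Set (Rn n)) : ℝ := sSup (Gset Φ A u)

/-- `w` has compact support contained in `A`. -/
def CptSupp {n : ℕ} (A : Set (Rn n)) (w : Rn n → ℝ) : Prop :=
  IsCompact (tsupport w) ∧ tsupport w ⊆ A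

/-- `u` is a minimizer of `G_{Φ^o}` by compact perturbations in `Ω̂`,
i.e. `u ∈ M_{Φ^o}(Ω̂)`. -/
def MinG {n : ℕ} (Φ : Rn1 n → ℝ) (Ω : Set (Rn n)) (u : Rn n → ℝ) : Prop :=
  BVlocFun Ω u ∧ ∀ A, CpCtd A Ω → ∀ v, BVlocFun Ω v →
    CptSupp A (fun x => u x - v x) → Gfun Φ u A ≤ Gfun Φ v A

/-- `u` is a minimizer of the total variation by compact perturbations in `Ω̂`. -/
def MinTV {n : ℕ} (Ω : Set (Rn n)) (u : Rn n → ℝ) : Prop :=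
  BVlocFun Ω u ∧ ∀ A, CpCtd A Ω → ∀ v, BVlocFun Ω v →
    CptSupp A (fun x => u x - v x) → TV u A ≤ TV v A

/-- Subgraph of `u : Ω̂ → ℝ`. -/
def sg {n : ℕ} (Ω : Set (Rn n)) (u : Rn n → ℝ) : Set (Rn1 n) :=
  {p | p.1 ∈ Ω ∧ p.2 < u p.1}

/-- `S` is locally a Lipschitz graph at `p`. -/
def IsLocLipGraphAt {n : ℕ} (S : Set (Rn1 n)) (p : Rn1 n) : Prop :=
  ∃ U : Set (Rn1 n), IsOpen U ∧ p ∈ U ∧ ∃ e : Rn1 n, enorm1 e = 1 ∧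
    ∃ g : Rn1 n → ℝ, (∃ L : NNReal, LipschitzOnWith L g {y | dotp y e = 0}) ∧
      S ∩ U = {z | ∃ y, dotp y e = 0 ∧ z = y + g y • e} ∩ U

/-- `Φ` is a partially monotone norm on `ℝ^{n+1}`. -/
def PartMono {n : ℕ} (Φ : Rn1 n → ℝ) : Prop :=
  ∀ ξ η : Rn1 n, Φ (ξ.1, 0) ≤ Φ (η.1, 0) → Φ ((0 : Rn n), ξ.2) ≤ Φ ((0 : Rn n), η.2) →
    Φ ξ ≤ Φ η

end


open Topology in
lemma int_fderiv_zero {n : ℕ} (f : Rn n → ℝ) (hf : ContDiff ℝ 1 f) (hc : HasCompactSupport f)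
    (e : Rn n) : ∫ x, fderiv ℝ f x e = 0 := by
  have h1 : Continuous (fun x => fderiv ℝ f x e) :=
    (hf.continuous_fderiv one_ne_zero).clm_apply continuous_const
  have h2 : HasCompactSupport (fun x => fderiv ℝ f x e) := hc.fderiv_apply (𝕜 := ℝ) e
  have := integral_mul_fderiv_eq_neg_fderiv_mul_of_integrable (μ := (volume : Measure (Rn n)))
    (f := fun _ => (1:ℝ)) (g := f) (v := e) (by simp)
    (by simpa using h1.integrable_of_hasCompactSupport h2)
    (by simpa using hf.continuous.integrable_of_hasCompactSupport hc)
    (fun x _ => by fun_prop) (fun x _ => (hf.differentiable one_ne_zero) x)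
  simpa using this

/-- full subgraph -/
def sgV {n : ℕ} (V : Rn n → ℝ) : Set (Rn1 n) := {p | p.2 < V p.1}

lemma sgV_null {n : ℕ} (V : Rn n → ℝ) (hV : AEStronglyMeasurable V volume) :
    NullMeasurableSet (sgV V) volume := by
  apply nullMeasurableSet_lt
  · exact measurable_snd.aemeasurable
  · exact (hV.aemeasurable.comp_quasiMeasurePreserving
      (Measure.quasiMeasurePreserving_fst (μ := (volume : Measure (Rn n)))
        (ν := (volume : Measure ℝ))))

lemma fub {n : ℕ} (V : Rn n → ℝ) (hV : AEStronglyMeasurable V volume) (g : Rn1 n → ℝ)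
    (hg : Integrable g volume) :
    Integrable (fun x => ∫ t in Iic (V x), g (x, t)) ∧
      ∫ z in sgV V, g z = ∫ x, ∫ t in Iic (V x), g (x, t) := by
  have h0 : Integrable ((sgV V).indicator g) ((volume : Measure (Rn n)).prod (volume : Measure ℝ)) := by
    exact hg.indicator₀ (sgV_null V hV)
  have h1 : ∀ x, ∫ t in Iic (V x), g (x, t) = ∫ t, (sgV V).indicator g (x, t) := by
    intro x
    rw [integral_Iic_eq_integral_Iio, ← integral_indicator measurableSet_Iio]
    rfl
  refine ⟨?_, ?_⟩
  · simp_rw [h1]; exact h0.integral_prod_left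
  · simp_rw [h1]
    rw [← integral_prod _ h0, ← integral_indicator₀ (sgV_null V hV)]
    rfl

lemma shift_Iic (F : ℝ → ℝ) (a : ℝ) : ∫ t in Iic a, F t = ∫ t in Iic 0, F (t + a) := by
  rw [← integral_indicator measurableSet_Iic, ← integral_indicator measurableSet_Iic,
    ← integral_add_right_eq_self _ a]
  congr 1
  ext t
  simp [indicator]

/-- shear homeomorphism -/
def shear {n : ℕ} (w : Rn n → ℝ) (hw : Continuous w) : Rn1 n ≃ₜ Rn1 n where
  toFun z := (z.1, z.2 + w z.1)
  invFun z := (z.1, z.2 - w z.1)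
  left_inv z := by simp
  right_inv z := by simp
  continuous_toFun := by fun_prop
  continuous_invFun := by fun_prop

lemma sliceC {n : ℕ} {f : Rn1 n → ℝ} (hc : HasCompactSupport f) (t : ℝ) :
    HasCompactSupport (fun x => f (x, t)) := by
  refine HasCompactSupport.of_support_subset_isCompact (hc.isCompact.image continuous_fst) ?_
  intro x hx
  exact ⟨(x, t), subset_tsupport _ hx, rfl⟩

lemma sliceC2 {n : ℕ} {f : Rn1 n → ℝ} (hc : HasCompactSupport f) (x : Rn n) :
    HasCompactSupport (fun t => f (x, t)) := by
  refine HasCompactSupport.of_support_subset_isCompact (hc.isCompact.image continuous_snd) ?_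
  intro t ht
  exact ⟨(x, t), subset_tsupport _ ht, rfl⟩

lemma graphC {n : ℕ} {E : Type*} [Zero E] {f : Rn1 n → E} (hc : HasCompactSupport f)
    (w : Rn n → ℝ) : HasCompactSupport (fun x => f (x, w x)) := by
  refine HasCompactSupport.of_support_subset_isCompact (hc.isCompact.image continuous_fst) ?_
  intro x hx
  exact ⟨(x, w x), subset_tsupport _ hx, rfl⟩

lemma ftc_t {n : ℕ} (f : Rn1 n → ℝ) (hf : ContDiff ℝ 1 f) (hc : HasCompactSupport f)
    (x : Rn n) (s : ℝ) : ∫ t in Iic s, fderiv ℝ f (x, t) ((0 : Rn n), (1 : ℝ)) = f (x, s) := by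
  have h := HasCompactSupport.integral_Iic_deriv_eq (f := fun t => f (x, t)) (by fun_prop)
    (sliceC2 hc x) s
  rw [← h]
  congr 1
  ext t
  have h1 : HasFDerivAt f (fderiv ℝ f (x, t)) (x, t) :=
    ((hf.differentiable one_ne_zero) _).hasFDerivAt
  have h2 : HasDerivAt (fun t : ℝ => ((x, t) : Rn1 n)) ((0 : Rn n), (1 : ℝ)) t :=
    (hasDerivAt_const t x).prodMk (hasDerivAt_id t)
  exact ((h1.comp_hasDerivAt t h2).deriv).symm

lemma core_scalar {n : ℕ} (f : Rn1 n → ℝ) (hf : ContDiff ℝ 1 f) (hc : HasCompactSupport f)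
    (w : Rn n → ℝ) (hw : ContDiff ℝ 1 w) (e : Rn n) :
    ∫ x, ∫ t in Iic (w x), fderiv ℝ f (x, t) (e, (0:ℝ)) =
      ∫ x, w x * fderiv ℝ (fun y => f (y, w y)) x e := by
  have hfd := hf.differentiable one_ne_zero
  have hwd := hw.differentiable one_ne_zero
  set F : Rn1 n → ℝ := fun z => f (z.1, z.2 + w z.1) with hF
  have hFC : ContDiff ℝ 1 F := by fun_prop
  have hFc : HasCompactSupport F := hc.comp_homeomorph (shear w hw.continuous)
  have hDF : ∀ z : Rn1 n, fderiv ℝ F z (e, (0:ℝ)) = fderiv ℝ f (z.1, z.2 + w z.1) (e, (0:ℝ)) +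
      fderiv ℝ w z.1 e * fderiv ℝ f (z.1, z.2 + w z.1) ((0 : Rn n), (1:ℝ)) := by
    intro z
    have h1 : HasFDerivAt f (fderiv ℝ f (z.1, z.2 + w z.1)) (z.1, z.2 + w z.1) :=
      (hfd _).hasFDerivAt
    have h2 : HasFDerivAt (fun z : Rn1 n => ((z.1, z.2 + w z.1) : Rn1 n)) _ z :=
      (hasFDerivAt_fst (𝕜 := ℝ) (p := z)).prodMk ((hasFDerivAt_snd (𝕜 := ℝ) (p := z)).add
        ((hwd z.1).hasFDerivAt.comp z (hasFDerivAt_fst (𝕜 := ℝ) (p := z))))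
    have h3 : HasFDerivAt F _ z := h1.comp z h2
    rw [h3.fderiv]
    have : ((e, fderiv ℝ w z.1 e) : Rn1 n) =
      (e, (0:ℝ)) + (fderiv ℝ w z.1 e) • ((0 : Rn n), (1:ℝ)) := by
      ext <;> simp
    change fderiv ℝ f (z.1, z.2 + w z.1) (e, (0:ℝ) + fderiv ℝ w z.1 e) = _
    rw [zero_add, this, map_add, map_smul, smul_eq_mul]
  have hDFi : Integrable (fun z => fderiv ℝ F z (e, (0:ℝ)))
      ((volume : Measure (Rn n)).prod (volume.restrict (Iic (0:ℝ)))) := by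
    have : Integrable (fun z => fderiv ℝ F z (e, (0:ℝ))) (volume : Measure (Rn1 n)) :=
      ((hFC.continuous_fderiv one_ne_zero).clm_apply continuous_const).integrable_of_hasCompactSupport
        (hFc.fderiv_apply (𝕜 := ℝ) _)
    have h2 := this.integrableOn (s := univ ×ˢ Iic (0:ℝ))
    rw [IntegrableOn, Measure.volume_eq_prod, ← Measure.prod_restrict, Measure.restrict_univ] at h2
    exact h2
  have hzero : ∫ x, ∫ t in Iic (0:ℝ), fderiv ℝ F (x, t) (e, (0:ℝ)) = 0 := by
    rw [integral_integral_swap (f := fun x t => fderiv ℝ F (x, t) (e, (0:ℝ))) hDFi]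
    have : ∀ t : ℝ, ∫ x, fderiv ℝ F (x, t) (e, (0:ℝ)) = 0 := by
      intro t
      refine Eq.trans ?_ (int_fderiv_zero (fun x => F (x, t)) (by fun_prop) (sliceC hFc t) e)
      congr 1
      ext x
      have h1 : HasFDerivAt F (fderiv ℝ F (x, t)) (x, t) :=
        ((hFC.differentiable one_ne_zero) _).hasFDerivAt
      have h2 : HasFDerivAt (fun x : Rn n => ((x, t) : Rn1 n)) _ x :=
        (hasFDerivAt_id (𝕜 := ℝ) x).prodMk (hasFDerivAt_const t x)
      have h3 : HasFDerivAt (fun x => F (x, t)) _ x :=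
        HasFDerivAt.comp (g := F) x h1 h2
      rw [h3.fderiv]
      simp
    simp [this]
  have hg1 : Continuous (fun x => fderiv ℝ w x e) :=
    (hw.continuous_fderiv one_ne_zero).clm_apply continuous_const
  set ζ : Rn n → ℝ := fun y => f (y, w y) with hζ
  have hζC : ContDiff ℝ 1 ζ := by fun_prop
  have hζc : HasCompactSupport ζ := graphC hc w
  have hζ1 : Continuous (fun x => fderiv ℝ ζ x e) :=
    (hζC.continuous_fderiv one_ne_zero).clm_apply continuous_const
  have hibp := integral_mul_fderiv_eq_neg_fderiv_mul_of_integrable (μ := (volume : Measure (Rn n)))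
    (f := w) (g := ζ) (v := e)
    ((hg1.mul hζC.continuous).integrable_of_hasCompactSupport (hζc.mul_left))
    ((hw.continuous.mul hζ1).integrable_of_hasCompactSupport
      ((hζc.fderiv_apply (𝕜 := ℝ) e).mul_left))
    ((hw.continuous.mul hζC.continuous).integrable_of_hasCompactSupport (hζc.mul_left))
    (fun x _ => hwd x) (fun x _ => (hζC.differentiable one_ne_zero) x)
  rw [hibp]
  have hx : ∀ x, ∫ t in Iic (w x), fderiv ℝ f (x, t) (e, (0:ℝ)) =
      (∫ t in Iic (0:ℝ), fderiv ℝ F (x, t) (e, (0:ℝ))) - fderiv ℝ w x e * ζ x := by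
    intro x
    have hfi : ∀ v : Rn1 n, Integrable (fun t => fderiv ℝ f (x, t) v) := fun v =>
      Continuous.integrable_of_hasCompactSupport
        (((hf.continuous_fderiv one_ne_zero).clm_apply continuous_const).comp
          (by fun_prop : Continuous fun t : ℝ => ((x, t) : Rn1 n)))
        (sliceC2 (f := fun z => fderiv ℝ f z v) (hc.fderiv_apply (𝕜 := ℝ) v) x)
    have e1 : ζ x = ∫ t in Iic (0:ℝ), fderiv ℝ f (x, t + w x) ((0 : Rn n), (1:ℝ)) := by
      rw [← shift_Iic (fun t => fderiv ℝ f (x, t) ((0 : Rn n), (1:ℝ))), ftc_t f hf hc]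
    rw [e1, shift_Iic, ← integral_const_mul, ← integral_sub]
    · congr 1
      ext t
      rw [hDF]
      simp
    · simp_rw [hDF]
      exact (((hfi _).comp_add_right (w x)).add
        (((hfi _).comp_add_right (w x)).const_mul _)).integrableOn
    · exact (((hfi _).comp_add_right (w x)).const_mul _).integrableOn
  simp_rw [hx]
  rw [integral_sub, hzero, zero_sub]
  · exact hDFi.integral_prod_left
  · exact ((hg1.mul hζC.continuous).integrable_of_hasCompactSupport (hζc.mul_left))

lemma divN_eq {n : ℕ} {η : Rn n → Rn n} (hη : ContDiff ℝ 1 η) (x : Rn n) :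
    divN η x = ∑ i, fderiv ℝ (fun y => η y i) x (EuclideanSpace.single i (1:ℝ)) := by
  unfold divN
  refine Finset.sum_congr rfl fun i _ => ?_
  have h1 : HasFDerivAt η (fderiv ℝ η x) x := ((hη.differentiable one_ne_zero) x).hasFDerivAt
  have h2 : HasFDerivAt (fun y => η y i) _ x :=
    (EuclideanSpace.proj i : Rn n →L[ℝ] ℝ).hasFDerivAt.comp x h1
  rw [h2.fderiv]
  rfl

lemma div1_eq {n : ℕ} {η : Rn1 n → Rn1 n} (hη : ContDiff ℝ 1 η) (z : Rn1 n) :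
    div1 η z = (∑ i, fderiv ℝ (fun y => (η y).1 i) z (EuclideanSpace.single i (1:ℝ), (0:ℝ))) +
      fderiv ℝ (fun y => (η y).2) z ((0 : Rn n), (1:ℝ)) := by
  unfold div1
  have h1 : HasFDerivAt η (fderiv ℝ η z) z := ((hη.differentiable one_ne_zero) z).hasFDerivAt
  have h3 : HasFDerivAt (fun y => (η y).2) _ z := (hasFDerivAt_snd (𝕜 := ℝ)).comp z h1
  rw [h3.fderiv]
  congr 1
  refine Finset.sum_congr rfl fun i _ => ?_
  have h2 : HasFDerivAt (fun y => (η y).1 i) _ z :=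
    (EuclideanSpace.proj i : Rn n →L[ℝ] ℝ).hasFDerivAt.comp z
      ((hasFDerivAt_fst (𝕜 := ℝ)).comp z h1)
  rw [h2.fderiv]
  rfl

lemma divN_cont {n : ℕ} {η : Rn n → Rn n} (hη : ContDiff ℝ 1 η) : Continuous (divN η) := by
  unfold divN
  have := hη.continuous_fderiv one_ne_zero
  fun_prop

lemma div1_cont {n : ℕ} {η : Rn1 n → Rn1 n} (hη : ContDiff ℝ 1 η) : Continuous (div1 η) := by
  unfold div1
  have := hη.continuous_fderiv one_ne_zero
  fun_prop

lemma divN_zero {n : ℕ} {η : Rn n → Rn n} {x : Rn n} (hx : x ∉ tsupport η) : divN η x = 0 := by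
  have : fderiv ℝ η x = 0 := by
    by_contra h
    exact hx (support_fderiv_subset ℝ h)
  simp [divN, this]

lemma div1_zero {n : ℕ} {η : Rn1 n → Rn1 n} {x : Rn1 n} (hx : x ∉ tsupport η) :
    div1 η x = 0 := by
  have : fderiv ℝ η x = 0 := by
    by_contra h
    exact hx (support_fderiv_subset ℝ h)
  simp [div1, this]

lemma divN_cs {n : ℕ} {η : Rn n → Rn n} (hc : HasCompactSupport η) :
    HasCompactSupport (divN η) :=
  HasCompactSupport.of_support_subset_isCompact hc.isCompact (fun x hx => by
    by_contra h; exact hx (divN_zero h))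

lemma div1_cs {n : ℕ} {η : Rn1 n → Rn1 n} (hc : HasCompactSupport η) :
    HasCompactSupport (div1 η) :=
  HasCompactSupport.of_support_subset_isCompact hc.isCompact (fun x hx => by
    by_contra h; exact hx (div1_zero h))

lemma div1_int {n : ℕ} {η : Rn1 n → Rn1 n} (hη : ContDiff ℝ 1 η) (hc : HasCompactSupport η) :
    Integrable (div1 η) volume :=
  (div1_cont hη).integrable_of_hasCompactSupport (div1_cs hc)

lemma core_vec {n : ℕ} (η : Rn1 n → Rn1 n) (hη : ContDiff ℝ 1 η) (hc : HasCompactSupport η)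
    (w : Rn n → ℝ) (hw : ContDiff ℝ 1 w) :
    ∫ x, ∫ t in Iic (w x), div1 η (x, t) =
      ∫ x, (w x * divN (fun y => (η (y, w y)).1) x + (η (x, w x)).2) := by
  have hci : ∀ i, HasCompactSupport (fun z => (η z).1 i) := fun i =>
    hc.comp_left (g := fun p : Rn1 n => p.1 i) (by simp)
  have hc2 : HasCompactSupport (fun z => (η z).2) :=
    hc.comp_left (g := fun p : Rn1 n => p.2) (by simp)
  have hCi : ∀ i, ContDiff ℝ 1 (fun z => (η z).1 i) := fun i => by fun_prop
  have hC2 : ContDiff ℝ 1 (fun z => (η z).2) := by fun_prop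
  have hint : ∀ (f : Rn1 n → ℝ) (v : Rn1 n), ContDiff ℝ 1 f → HasCompactSupport f →
      Integrable (fun z => fderiv ℝ f z v) := fun f v hf hfc =>
    ((hf.continuous_fderiv one_ne_zero).clm_apply continuous_const).integrable_of_hasCompactSupport
      (hfc.fderiv_apply (𝕜 := ℝ) v)
  have hint2 : ∀ (f : Rn1 n → ℝ) (v : Rn1 n) (x : Rn n), ContDiff ℝ 1 f → HasCompactSupport f →
      Integrable (fun t => fderiv ℝ f (x, t) v) := fun f v x hf hfc =>
    Continuous.integrable_of_hasCompactSupport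
        (((hf.continuous_fderiv one_ne_zero).clm_apply continuous_const).comp
          (by fun_prop : Continuous fun t : ℝ => ((x, t) : Rn1 n)))
        (sliceC2 (f := fun z => fderiv ℝ f z v) (hfc.fderiv_apply (𝕜 := ℝ) v) x)
  have hwm : AEStronglyMeasurable w volume := hw.continuous.aestronglyMeasurable
  have hL : ∀ x, ∫ t in Iic (w x), div1 η (x, t) =
      (∑ i, ∫ t in Iic (w x), fderiv ℝ (fun y => (η y).1 i) (x, t)
        (EuclideanSpace.single i (1:ℝ), (0:ℝ))) + (η (x, w x)).2 := by
    intro x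
    simp_rw [div1_eq hη]
    rw [integral_add, integral_finsetSum, ftc_t _ hC2 hc2]
    · intro i _
      exact (hint2 _ _ x (hCi i) (hci i)).integrableOn
    · exact integrable_finsetSum _ fun i _ => (hint2 _ _ x (hCi i) (hci i)).integrableOn
    · exact (hint2 _ _ x hC2 hc2).integrableOn
  simp_rw [hL]
  have hζ2 : Integrable (fun x => (η (x, w x)).2) := by
    apply Continuous.integrable_of_hasCompactSupport
    · have := hη.continuous; have := hw.continuous; fun_prop
    · exact graphC hc2 w
  have hζi : ∀ i, Integrable (fun x => w x * fderiv ℝ (fun y => (η (y, w y)).1 i) x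
      (EuclideanSpace.single i (1:ℝ))) := by
    intro i
    have hz : ContDiff ℝ 1 (fun y => (η (y, w y)).1 i) := by fun_prop
    exact (hw.continuous.mul ((hz.continuous_fderiv one_ne_zero).clm_apply
      continuous_const)).integrable_of_hasCompactSupport
      (((graphC (hci i) w).fderiv_apply (𝕜 := ℝ) _).mul_left)
  rw [integral_add _ hζ2, integral_finsetSum]
  · have hR : ∀ x, w x * divN (fun y => (η (y, w y)).1) x = ∑ i, w x *
        fderiv ℝ (fun y => (η (y, w y)).1 i) x (EuclideanSpace.single i (1:ℝ)) := by
      intro x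
      rw [divN_eq (by fun_prop), Finset.mul_sum]
    simp_rw [hR]
    rw [integral_add _ hζ2, integral_finsetSum]
    · congr 1
      refine Finset.sum_congr rfl fun i _ => ?_
      exact core_scalar _ (hCi i) (hci i) w hw _
    · exact fun i _ => hζi i
    · exact integrable_finsetSum _ fun i _ => hζi i
  · exact fun i _ => (fub w hwm _ (hint _ _ (hCi i) (hci i))).1
  · exact integrable_finsetSum _ fun i _ => (fub w hwm _ (hint _ _ (hCi i) (hci i))).1

/-- pairing bound -/
def PB {n : ℕ} (Φ : Rn1 n → ℝ) (A : Set (Rn n)) (V : Rn n → ℝ) (b : ℝ) : Prop :=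
  ∀ ζ : Rn n → Rn1 n, ContDiff ℝ 1 ζ → HasCompactSupport ζ → tsupport ζ ⊆ A →
    (∀ x, Φ (ζ x) ≤ 1) → ∫ x, (V x * divN (fun y => (ζ y).1) x + (ζ x).2) ≤ b

lemma divN_shift {n : ℕ} (ζ : Rn n → Rn n) (x y : Rn n) :
    divN (fun x' => ζ (x' + y)) x = divN ζ (x + y) := by
  unfold divN
  rw [fderiv_comp_add_right]

open scoped Convolution in
lemma molli {n : ℕ} (Φ : Rn1 n → ℝ) (A : Set (Rn n)) (V : Rn n → ℝ) (hV : Integrable V) (b : ℝ)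
    (hb : PB Φ A V b) (φ : ContDiffBump (0 : Rn n)) (ζ : Rn n → Rn1 n) (hζ : ContDiff ℝ 1 ζ)
    (hc : HasCompactSupport ζ) (hs : Metric.cthickening φ.rOut (tsupport ζ) ⊆ A)
    (h1 : ∀ x, Φ (ζ x) ≤ 1) :
    ∫ x, ((φ.normed volume ⋆[ContinuousLinearMap.lsmul ℝ ℝ, volume] V) x *
      divN (fun y => (ζ y).1) x + (ζ x).2) ≤ b := by
  set d := divN (fun y => (ζ y).1) with hd
  have hζ1C : ContDiff ℝ 1 (fun y => (ζ y).1) := by fun_prop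
  have hζ1c : HasCompactSupport (fun y => (ζ y).1) :=
    hc.comp_left (g := fun p : Rn1 n => p.1) (by simp)
  have hζ2c : HasCompactSupport (fun y => (ζ y).2) :=
    hc.comp_left (g := fun p : Rn1 n => p.2) (by simp)
  have hdC : Continuous d := divN_cont hζ1C
  have hdc : HasCompactSupport d := divN_cs hζ1c
  have h2i : Integrable (fun x => (ζ x).2) :=
    Continuous.integrable_of_hasCompactSupport (by have := hζ.continuous; fun_prop) hζ2c
  obtain ⟨M, hM⟩ := hdc.exists_bound_of_continuous hdC
  set ρ := φ.normed (volume : Measure (Rn n)) with hρ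
  have hρi : Integrable ρ := φ.integrable_normed
  have hI : Integrable (fun p : Rn n × Rn n => ρ p.2 * V (p.1 - p.2))
      ((volume : Measure (Rn n)).prod volume) :=
    Integrable.convolution_integrand (ContinuousLinearMap.lsmul ℝ ℝ) hρi hV
  have hI2 : Integrable (fun p : Rn n × Rn n => (ρ p.2 * V (p.1 - p.2)) * d p.1)
      ((volume : Measure (Rn n)).prod volume) := by
    refine hI.mul_bdd (c := M) (hdC.comp continuous_fst).aestronglyMeasurable ?_
    exact Eventually.of_forall fun p => hM p.1
  have hI3 : Integrable (fun p : Rn n × Rn n => (ζ p.1).2 * ρ p.2)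
      ((volume : Measure (Rn n)).prod volume) := h2i.mul_prod hρi
  have e0 : ∀ x, (ρ ⋆[ContinuousLinearMap.lsmul ℝ ℝ, volume] V) x * d x + (ζ x).2 =
      ∫ y, ((ρ y * V (x - y)) * d x + (ζ x).2 * ρ y) ∨
      ¬ Integrable (fun y => (ρ y * V (x - y)) * d x) := by
    intro x
    by_cases hx : Integrable (fun y => (ρ y * V (x - y)) * d x)
    · left
      rw [integral_add hx (hρi.const_mul _), integral_mul_const, integral_const_mul, hρ,
        φ.integral_normed, mul_one]
      rfl
    · exact Or.inr hx
  have e1 : ∫ x, ((ρ ⋆[ContinuousLinearMap.lsmul ℝ ℝ, volume] V) x * d x + (ζ x).2) =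
      ∫ x, ∫ y, ((ρ y * V (x - y)) * d x + (ζ x).2 * ρ y) := by
    refine integral_congr_ae ?_
    filter_upwards [hI2.prod_right_ae] with x hx
    exact (e0 x).resolve_right (not_not.2 hx)
  rw [e1, integral_integral_swap (f := fun x y => ((ρ y * V (x - y)) * d x + (ζ x).2 * ρ y))
    (hI2.add hI3)]
  have hsw := (hI2.add hI3).integral_prod_right
  have e2 : ∀ y, ∫ x, ((ρ y * V (x - y)) * d x + (ζ x).2 * ρ y) ≤ ρ y * b := by
    intro y
    have : ∀ x, ((ρ y * V (x - y)) * d x + (ζ x).2 * ρ y) =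
      ρ y * (V (x - y) * d x + (ζ x).2) := fun x => by ring
    simp_rw [this]
    rw [integral_const_mul]
    by_cases hy : ρ y = 0
    · simp [hy]
    refine mul_le_mul_of_nonneg_left ?_ (φ.nonneg_normed y)
    have hyr : ‖y‖ < φ.rOut := by
      have : y ∈ Function.support ρ := hy
      rw [hρ, φ.support_normed_eq] at this
      simpa using this
    rw [← integral_add_right_eq_self _ y]
    have hts : tsupport (fun x => ζ (x + y)) ⊆ A := by
      intro x hx
      apply hs
      have h3 : x + y ∈ tsupport ζ :=
        tsupport_comp_subset_preimage ζ (continuous_add_const y) hx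
      exact Metric.mem_cthickening_of_dist_le x (x + y) _ _ h3 (by simpa using hyr.le)
    have := hb (fun x => ζ (x + y)) (by fun_prop)
      (hc.comp_homeomorph (Homeomorph.addRight y)) hts (fun x => h1 _)
    simpa [divN_shift (fun x => (ζ x).1), ← hd] using this
  calc _ ≤ ∫ y, ρ y * b := integral_mono hsw (hρi.mul_const b) e2
    _ = b := by rw [integral_mul_const, hρ, φ.integral_normed, one_mul]

lemma prim_cont (g : ℝ → ℝ) (hg : Integrable g) : Continuous (fun s => ∫ t in Iic s, g t) := by
  have : (fun s => ∫ t in Iic s, g t) = fun s => (∫ t in (0:ℝ)..s, g t) + ∫ t in Iic 0, g t := by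
    ext s
    rw [← intervalIntegral.integral_Iic_sub_Iic hg.integrableOn hg.integrableOn]
    ring
  rw [this]
  exact (intervalIntegral.continuous_primitive (fun a b => hg.intervalIntegrable) 0).add
    continuous_const

open scoped Convolution Topology in
lemma sub_le {n : ℕ} (Φ : Rn1 n → ℝ) (hΦ : ∀ x, Φ (-x) = Φ x) (A : Set (Rn n)) (hA : IsOpen A)
    (V : Rn n → ℝ) (hV : Integrable V) (b : ℝ) (hb : PB Φ A V b)
    (η : Rn1 n → Rn1 n) (hη : ContDiff ℝ 1 η) (hc : HasCompactSupport η)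
    (hs : tsupport η ⊆ A ×ˢ univ) (h1 : ∀ z, Φ (η z) ≤ 1) :
    -∫ z in sgV V, div1 η z ≤ b := by
  set K := Prod.fst '' tsupport η with hK
  have hKc : IsCompact K := hc.isCompact.image continuous_fst
  have hKA : K ⊆ A := by
    rintro _ ⟨z, hz, rfl⟩
    exact (hs hz).1
  obtain ⟨δ, hδ, hδA⟩ := hKc.exists_cthickening_subset_open hA hKA
  let φ : ℕ → ContDiffBump (0 : Rn n) := fun j =>
    { rIn := δ / (j + 1) / 2, rOut := δ / (j + 1), rIn_pos := by positivity,
      rIn_lt_rOut := half_lt_self (by positivity) }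
  have hφ0 : Tendsto (fun j => (φ j).rOut) atTop (𝓝 0) := by
    have := (tendsto_one_div_add_atTop_nhds_zero_nat (𝕜 := ℝ)).const_mul δ
    simpa [φ, div_eq_mul_inv] using this
  have hφδ : ∀ j, (φ j).rOut ≤ δ := fun j => by
    change δ / (j + 1) ≤ δ
    exact div_le_self hδ.le (by simp)
  set w : ℕ → Rn n → ℝ := fun j =>
    (φ j).normed volume ⋆[ContinuousLinearMap.lsmul ℝ ℝ, volume] V with hw
  have hwC : ∀ j, ContDiff ℝ 1 (w j) := fun j =>
    (φ j).hasCompactSupport_normed.contDiff_convolution_left _ ((φ j).contDiff_normed (n := 1))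
      hV.locallyIntegrable
  have hwt : ∀ᵐ x, Tendsto (fun j => w j x) atTop (𝓝 (V x)) :=
    ContDiffBump.ae_convolution_tendsto_right_of_locallyIntegrable (K := 2) hφ0
      (Eventually.of_forall fun j => by
        change δ / (j + 1) ≤ 2 * (δ / (j + 1) / 2); linarith) hV.locallyIntegrable
  have hdi := div1_int hη hc
  have hsl : ∀ x, Integrable (fun t => div1 η (x, t)) := fun x =>
    ((div1_cont hη).comp (by fun_prop : Continuous fun t : ℝ => ((x, t) : Rn1 n))
      ).integrable_of_hasCompactSupport (sliceC2 (div1_cs hc) x)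
  have hlim : Tendsto (fun j => ∫ x, ∫ t in Iic (w j x), div1 η (x, t)) atTop
      (𝓝 (∫ x, ∫ t in Iic (V x), div1 η (x, t))) := by
    refine tendsto_integral_of_dominated_convergence (fun x => ∫ t, ‖div1 η (x, t)‖) ?_ ?_ ?_ ?_
    · exact fun j => (fub (w j) (hwC j).continuous.aestronglyMeasurable _ hdi).1.1
    · exact Integrable.integral_prod_left (f := fun z => ‖div1 η z‖) hdi.norm
    · intro j
      refine Eventually.of_forall fun x => ?_
      exact (norm_integral_le_integral_norm _).trans
        (setIntegral_le_integral (hsl x).norm (Eventually.of_forall fun t => norm_nonneg _))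
    · filter_upwards [hwt] with x hx
      exact ((prim_cont _ (hsl x)).tendsto (V x)).comp hx
  rw [(fub V hV.1 _ hdi).2]
  refine le_of_tendsto hlim.neg (Eventually.of_forall fun j => ?_)
  rw [core_vec η hη hc (w j) (hwC j), ← integral_neg]
  have hwj := hwC j
  have hts : tsupport (fun x => -η (x, w j x)) ⊆ K := by
    refine closure_minimal ?_ hKc.isClosed
    intro x hx
    refine ⟨(x, w j x), subset_tsupport _ ?_, rfl⟩
    intro h
    exact hx (by simp [h])
  have := molli Φ A V hV b hb (φ j) (fun x => -η (x, w j x)) (by fun_prop)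
    ((graphC hc (w j)).comp_left (g := fun p : Rn1 n => -p) (by simp))
    ((Metric.cthickening_mono (hφδ j) _).trans
      ((Metric.cthickening_subset_of_subset _ hts).trans hδA))
    (fun x => by rw [hΦ]; exact h1 _)
  refine le_of_eq_of_le ?_ this
  congr 1
  ext x
  have hn : divN (fun y => (-η (y, w j y)).1) x = - divN (fun y => (η (y, w j y)).1) x := by
    unfold divN
    have : (fun y => (-η (y, w j y)).1) = -(fun y => (η (y, w j y)).1) := rfl
    rw [this, fderiv_neg]
    simp
  rw [hn]
  simp only [hw, Prod.snd_neg]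
  ring

/-- cut-off in the vertical variable -/
noncomputable def cutf (k j t : ℝ) : ℝ :=
  Real.smoothTransition (j * (k - t)) * Real.smoothTransition (j * (k + t))

/-- universal constant -/
noncomputable def C0 : ℝ := 2 * ∫ t, |deriv Real.smoothTransition t|

lemma cutf_C (k j : ℝ) : ContDiff ℝ 1 (cutf k j) := by
  have h : ContDiff ℝ 1 Real.smoothTransition := Real.smoothTransition.contDiff (n := 1)
  unfold cutf
  fun_prop

lemma cutf_nonneg (k j t : ℝ) : 0 ≤ cutf k j t :=
  mul_nonneg (Real.smoothTransition.nonneg _) (Real.smoothTransition.nonneg _)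

lemma cutf_le (k j t : ℝ) : cutf k j t ≤ 1 :=
  mul_le_one₀ (Real.smoothTransition.le_one _) (Real.smoothTransition.nonneg _)
    (Real.smoothTransition.le_one _)

lemma cutf_one {k j t : ℝ} (h : 1 ≤ j * (k - |t|)) (hj : 0 ≤ j) : cutf k j t = 1 := by
  unfold cutf
  rw [Real.smoothTransition.one_of_one_le, Real.smoothTransition.one_of_one_le, one_mul]
  · exact h.trans (mul_le_mul_of_nonneg_left (by linarith [neg_abs_le t]) hj)
  · exact h.trans (mul_le_mul_of_nonneg_left (by linarith [le_abs_self t]) hj)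

lemma cutf_zero {k j t : ℝ} (h : k ≤ |t|) (hj : 0 ≤ j) : cutf k j t = 0 := by
  unfold cutf
  rcases le_abs.1 h with h | h
  · rw [Real.smoothTransition.zero_of_nonpos (mul_nonpos_of_nonneg_of_nonpos hj (by linarith)),
      zero_mul]
  · rw [Real.smoothTransition.zero_of_nonpos (x := j * (k + t))
      (mul_nonpos_of_nonneg_of_nonpos hj (by linarith)), mul_zero]

lemma cutf_cs (k j : ℝ) (hj : 0 ≤ j) : HasCompactSupport (cutf k j) := by
  refine HasCompactSupport.of_support_subset_isCompact (isCompact_Icc (a := -k) (b := k)) ?_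
  intro t ht
  have : |t| < k := by
    by_contra h
    exact ht (cutf_zero (not_lt.1 h) hj)
  exact ⟨(abs_lt.1 this).1.le, (abs_lt.1 this).2.le⟩

lemma dS_int : Integrable (fun t => |deriv Real.smoothTransition t|) := by
  have h : ContDiff ℝ 1 Real.smoothTransition := Real.smoothTransition.contDiff (n := 1)
  refine ((h.continuous_deriv le_rfl).abs).integrable_of_hasCompactSupport ?_
  refine HasCompactSupport.of_support_subset_isCompact (isCompact_Icc (a := (0:ℝ)) (b := 1)) ?_
  intro t ht
  by_contra hn
  apply ht
  simp only [mem_Icc, not_and_or, not_le] at hn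
  have : deriv Real.smoothTransition t = 0 := by
    rcases hn with hn | hn
    · have : Real.smoothTransition =ᶠ[nhds t] fun _ => 0 := by
        filter_upwards [Iio_mem_nhds hn] with s hs
        exact Real.smoothTransition.zero_of_nonpos (le_of_lt hs)
      rw [this.deriv_eq]; simp
    · have : Real.smoothTransition =ᶠ[nhds t] fun _ => 1 := by
        filter_upwards [Ioi_mem_nhds hn] with s hs
        exact Real.smoothTransition.one_of_one_le (le_of_lt hs)
      rw [this.deriv_eq]; simp
  simp [this]

lemma cutf_dint (k j : ℝ) (hj : 0 ≤ j) : Integrable (fun t => |deriv (cutf k j) t|) :=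
  (((cutf_C k j).continuous_deriv le_rfl).abs).integrable_of_hasCompactSupport
    (((cutf_cs k j hj).deriv).comp_left (g := fun x : ℝ => |x|) (by simp))

lemma cutf_dle (k j : ℝ) (hj : 0 < j) : ∫ t, |deriv (cutf k j) t| ≤ C0 := by
  have h : ContDiff ℝ 1 Real.smoothTransition := Real.smoothTransition.contDiff (n := 1)
  have hd := h.differentiable one_ne_zero
  set g := fun t => |deriv Real.smoothTransition t| with hg
  have hb : ∀ t, |deriv (cutf k j) t| ≤ j * g (j * (k - t)) + j * g (j * (k + t)) := by
    intro t
    have h1 : HasDerivAt (fun t => Real.smoothTransition (j * (k - t)))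
        (deriv Real.smoothTransition (j * (k - t)) * (j * (-1))) t :=
      (hd _).hasDerivAt.comp t (((hasDerivAt_id t).const_sub k).const_mul j)
    have h2 : HasDerivAt (fun t => Real.smoothTransition (j * (k + t)))
        (deriv Real.smoothTransition (j * (k + t)) * (j * 1)) t :=
      (hd _).hasDerivAt.comp t (((hasDerivAt_id t).const_add k).const_mul j)
    have h3 : HasDerivAt (cutf k j) _ t := h1.mul h2
    rw [h3.deriv]
    refine (abs_add_le _ _).trans (add_le_add ?_ ?_)
    · rw [abs_mul, abs_mul, abs_mul, abs_neg, abs_one, mul_one, abs_of_pos hj,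
        abs_of_nonneg (Real.smoothTransition.nonneg _), mul_comm j (g _)]
      exact mul_le_of_le_one_right (mul_nonneg (abs_nonneg _) hj.le) (Real.smoothTransition.le_one _)
    · rw [abs_mul, abs_mul, mul_one, abs_of_pos hj,
        abs_of_nonneg (Real.smoothTransition.nonneg _), mul_comm j (g _)]
      exact mul_le_of_le_one_left (mul_nonneg (abs_nonneg _) hj.le) (Real.smoothTransition.le_one _)
  have hgi : Integrable (fun t => g (j * t)) := dS_int.comp_mul_left' hj.ne'
  have i1 : Integrable (fun t => j * g (j * (k - t))) := (hgi.comp_sub_left k).const_mul j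
  have i2 : Integrable (fun t => j * g (j * (k + t))) := (hgi.comp_add_left k).const_mul j
  have hgm : ∫ t, g (j * t) = j⁻¹ * ∫ t, g t := by
    rw [Measure.integral_comp_mul_left, abs_of_pos (inv_pos.2 hj), smul_eq_mul]
  calc ∫ t, |deriv (cutf k j) t| ≤ ∫ t, (j * g (j * (k - t)) + j * g (j * (k + t))) :=
        integral_mono (cutf_dint k j hj.le) (i1.add i2) hb
    _ = C0 := by
        rw [integral_add i1 i2, integral_const_mul, integral_const_mul,
          integral_sub_left_eq_self (fun t => g (j * t)) volume k,
          integral_add_left_eq_self (fun t => g (j * t)) k, hgm, C0]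
        field_simp
        ring

lemma cutf_dzero {k j t : ℝ} (hj : 1 ≤ j) (ht : |t| < k - 1) : deriv (cutf k j) t = 0 := by
  have : cutf k j =ᶠ[nhds t] fun _ => 1 := by
    have : {s : ℝ | |s| < k - 1} ∈ nhds t :=
      (isOpen_lt continuous_abs continuous_const).mem_nhds ht
    filter_upwards [this] with s hs
    apply cutf_one _ (by linarith)
    have hs' : |s| < k - 1 := hs
    nlinarith
  rw [this.deriv_eq]; simp

lemma div1_smul {n : ℕ} {η : Rn1 n → Rn1 n} (hη : ContDiff ℝ 1 η) {ψ : ℝ → ℝ}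
    (hψ : ContDiff ℝ 1 ψ) (z : Rn1 n) :
    div1 (fun z => ψ z.2 • η z) z = ψ z.2 * div1 η z + deriv ψ z.2 * (η z).2 := by
  have h1 : HasFDerivAt η (fderiv ℝ η z) z := ((hη.differentiable one_ne_zero) z).hasFDerivAt
  have h2 : HasFDerivAt (fun z : Rn1 n => ψ z.2) _ z :=
    HasDerivAt.comp_hasFDerivAt (h₂ := ψ) z
    ((hψ.differentiable one_ne_zero) z.2).hasDerivAt (hasFDerivAt_snd (𝕜 := ℝ))
  have h3 : HasFDerivAt (fun z : Rn1 n => ψ z.2 • η z) _ z := h2.smul h1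
  unfold div1
  rw [h3.fderiv]
  simp [mul_add, Finset.mul_sum]
  ring

open scoped Topology in
lemma cut {n : ℕ} (E1 E2 : Set (Rn1 n)) (hE1 : NullMeasurableSet E1) (hE2 : NullMeasurableSet E2)
    (k : ℝ) (η : Rn1 n → Rn1 n) (hη : ContDiff ℝ 1 η) (hc : HasCompactSupport η)
    (M : ℝ) (hM : ∀ z, |(η z).2| ≤ M) (D : Set (Rn n)) (hD : MeasurableSet D)
    (hDf : volume D < ⊤)
    (hDE : ∀ z, k - 1 ≤ |z.2| → η z ≠ 0 → ¬(z ∈ E1 ↔ z ∈ E2) → z.1 ∈ D) (a b : ℝ)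
    (ha : ∀ ψ : ℝ → ℝ, ContDiff ℝ 1 ψ → (∀ t, 0 ≤ ψ t ∧ ψ t ≤ 1) → (∀ t, |t| ≤ k - 1 → ψ t = 1) →
      -∫ z in E1, div1 (fun z => ψ z.2 • η z) z ≤ a)
    (hb : ∀ ψ : ℝ → ℝ, ContDiff ℝ 1 ψ → (∀ t, 0 ≤ ψ t ∧ ψ t ≤ 1) → (∀ t, |t| ≤ k - 1 → ψ t = 1) →
      -∫ z in E2, div1 (fun z => (1 - ψ z.2) • η z) z ≤ b) :
    -∫ z in {z : Rn1 n | (|z.2| < k ∧ z ∈ E1) ∨ (¬ |z.2| < k ∧ z ∈ E2)}, div1 η z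
      ≤ a + b + M * C0 * volume.real D := by
  set F := {z : Rn1 n | (|z.2| < k ∧ z ∈ E1) ∨ (¬ |z.2| < k ∧ z ∈ E2)} with hF
  set S := {z : Rn1 n | |z.2| < k} with hS
  have hSm : MeasurableSet S :=
    (isOpen_lt (continuous_abs.comp continuous_snd) continuous_const).measurableSet
  have hdi := div1_int hη hc
  have hM0 : 0 ≤ M := (abs_nonneg _).trans (hM 0)
  let ψ : ℕ → ℝ → ℝ := fun j => cutf k ((j : ℝ) + 1)
  have hj1 : ∀ j : ℕ, (1:ℝ) ≤ (j:ℝ) + 1 := fun j => by simp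
  have hj0 : ∀ j : ℕ, (0:ℝ) < (j:ℝ) + 1 := fun j => by positivity
  have hlim : ∀ t, Tendsto (fun j => ψ j t) atTop (𝓝 (if |t| < k then 1 else 0)) := by
    intro t
    split_ifs with ht
    · refine tendsto_const_nhds.congr' ?_
      obtain ⟨N, hN⟩ := exists_nat_gt (1 / (k - |t|))
      filter_upwards [eventually_ge_atTop N] with j hj
      refine (cutf_one ?_ (hj0 j).le).symm
      have h1 : 0 < k - |t| := by linarith
      rw [← div_le_iff₀ h1]
      have : (N:ℝ) ≤ j := by exact_mod_cast hj
      linarith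
    · refine tendsto_const_nhds.congr fun j => (cutf_zero (not_lt.1 ht) (hj0 j).le).symm
  have hψc : ∀ j, Continuous (fun z : Rn1 n => ψ j z.2) := fun j =>
    (cutf_C k _).continuous.comp continuous_snd
  have L1 : Tendsto (fun j => ∫ z in E1, ψ j z.2 * div1 η z) atTop
      (𝓝 (∫ z in E1 ∩ S, div1 η z)) := by
    rw [← setIntegral_indicator hSm]
    refine tendsto_integral_of_dominated_convergence (fun z => ‖div1 η z‖) ?_
      hdi.norm.integrableOn ?_ ?_
    · exact fun j => ((hψc j).mul (div1_cont hη)).aestronglyMeasurable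
    · refine fun j => Eventually.of_forall fun z => ?_
      rw [norm_mul, Real.norm_eq_abs, abs_of_nonneg (cutf_nonneg _ _ _)]
      exact mul_le_of_le_one_left (norm_nonneg _) (cutf_le _ _ _)
    · refine Eventually.of_forall fun z => ?_
      have := (hlim z.2).mul_const (div1 η z)
      convert this using 2
      simp [indicator, hS]
  have L2 : Tendsto (fun j => ∫ z in E2, (1 - ψ j z.2) * div1 η z) atTop
      (𝓝 (∫ z in E2 \ S, div1 η z)) := by
    rw [sdiff_eq, ← setIntegral_indicator hSm.compl]
    refine tendsto_integral_of_dominated_convergence (fun z => ‖div1 η z‖) ?_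
      hdi.norm.integrableOn ?_ ?_
    · exact fun j => ((continuous_const.sub (hψc j)).mul (div1_cont hη)).aestronglyMeasurable
    · refine fun j => Eventually.of_forall fun z => ?_
      have h1 : 0 ≤ 1 - ψ j z.2 := sub_nonneg.2 (cutf_le _ _ _)
      rw [norm_mul, Real.norm_eq_abs, abs_of_nonneg h1]
      exact mul_le_of_le_one_left (norm_nonneg _)
        (by have := cutf_nonneg k ((j:ℝ) + 1) z.2; simp only [ψ]; linarith)
    · refine Eventually.of_forall fun z => ?_
      have := ((hlim z.2).const_sub 1).mul_const (div1 η z)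
      convert this using 2
      by_cases hz : |z.2| < k <;> simp [indicator, hS, hz]
  have hFs : ∫ z in F, div1 η z = (∫ z in E1 ∩ S, div1 η z) + ∫ z in E2 \ S, div1 η z := by
    rw [← integral_inter_add_sdiff hSm hdi.integrableOn]
    have e1 : F ∩ S = E1 ∩ S := by
      ext z; simp only [hF, hS, mem_inter_iff, mem_ofPred_eq]; tauto
    have e2 : F \ S = E2 \ S := by
      ext z; simp only [hF, hS, Set.mem_sdiff, mem_ofPred_eq]; tauto
    rw [e1, e2]
  rw [hFs]
  refine le_of_tendsto (L1.add L2).neg (Eventually.of_forall fun j => ?_)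
  have hψC : ContDiff ℝ 1 (ψ j) := cutf_C k _
  have hψ1 : ∀ t, |t| ≤ k - 1 → ψ j t = 1 := fun t ht =>
    cutf_one (by nlinarith [hj1 j]) (hj0 j).le
  have A1 := ha (ψ j) hψC (fun t => ⟨cutf_nonneg _ _ _, cutf_le _ _ _⟩) hψ1
  have A2 := hb (ψ j) hψC (fun t => ⟨cutf_nonneg _ _ _, cutf_le _ _ _⟩) hψ1
  have d1 : ∀ z, div1 (fun z => ψ j z.2 • η z) z = ψ j z.2 * div1 η z + deriv (ψ j) z.2 * (η z).2 :=
    div1_smul hη hψC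
  have d2 : ∀ z, div1 (fun z => (1 - ψ j z.2) • η z) z =
      (1 - ψ j z.2) * div1 η z - deriv (ψ j) z.2 * (η z).2 := by
    intro z
    rw [div1_smul (ψ := fun t => 1 - ψ j t) hη (by fun_prop)]
    simp
    ring
  have hη2c : HasCompactSupport (fun z => (η z).2) :=
    hc.comp_left (g := fun p : Rn1 n => p.2) (by simp)
  have hηc := hη.continuous
  have hp : Integrable (fun z : Rn1 n => deriv (ψ j) z.2 * (η z).2) := by
    refine Continuous.integrable_of_hasCompactSupport ?_ hη2c.mul_left
    exact ((hψC.continuous_deriv le_rfl).comp continuous_snd).mul (by fun_prop)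
  have hq1 : Integrable (fun z : Rn1 n => ψ j z.2 * div1 η z) :=
    ((hψc j).mul (div1_cont hη)).integrable_of_hasCompactSupport (div1_cs hc).mul_left
  have hq2 : Integrable (fun z : Rn1 n => (1 - ψ j z.2) * div1 η z) :=
    ((continuous_const.sub (hψc j)).mul (div1_cont hη)).integrable_of_hasCompactSupport
      (div1_cs hc).mul_left
  simp_rw [d1] at A1
  simp_rw [d2] at A2
  rw [integral_add hq1.integrableOn hp.integrableOn] at A1
  rw [integral_sub hq2.integrableOn hp.integrableOn] at A2
  have key : (∫ z in E1, deriv (ψ j) z.2 * (η z).2) - ∫ z in E2, deriv (ψ j) z.2 * (η z).2 ≤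
      M * C0 * volume.real D := by
    rw [← integral_indicator₀ hE1, ← integral_indicator₀ hE2,
      ← integral_sub (hp.indicator₀ hE1) (hp.indicator₀ hE2)]
    have hDi : Integrable (D.indicator (fun _ => (1:ℝ))) :=
      (integrable_indicator_iff hD).2 (by simpa using hDf)
    have hbi : Integrable (fun z : Rn1 n => (D.indicator (fun _ => (1:ℝ)) z.1) *
        (M * |deriv (ψ j) z.2|)) ((volume : Measure (Rn n)).prod (volume : Measure ℝ)) :=
      hDi.mul_prod ((cutf_dint k _ (hj0 j).le).const_mul M)
    calc _ ≤ ∫ z : Rn1 n, (D.indicator (fun _ => (1:ℝ)) z.1) * (M * |deriv (ψ j) z.2|) := by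
          refine integral_mono ((hp.indicator₀ hE1).sub (hp.indicator₀ hE2)) hbi fun z => ?_
          have hnn : 0 ≤ (D.indicator (fun _ => (1:ℝ)) z.1) * (M * |deriv (ψ j) z.2|) :=
            mul_nonneg (indicator_nonneg (fun _ _ => zero_le_one) _) (by positivity)
          by_cases hz1 : |z.2| < k - 1
          · have : deriv (ψ j) z.2 = 0 := cutf_dzero (hj1 j) hz1
            simp [indicator, this]
          by_cases hz2 : η z = 0
          · refine le_trans (le_of_eq ?_) hnn
            simp [indicator, hz2]
          by_cases hz3 : z ∈ E1 ↔ z ∈ E2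
          · refine le_trans (le_of_eq ?_) hnn
            by_cases h : z ∈ E1
            · simp [indicator, h, hz3.1 h]
            · simp [indicator, h, mt hz3.2 h]
          have hzD := hDE z (not_lt.1 hz1) hz2 hz3
          rw [indicator_of_mem hzD, one_mul]
          have hab : |deriv (ψ j) z.2 * (η z).2| ≤ M * |deriv (ψ j) z.2| := by
            rw [abs_mul, mul_comm]
            exact mul_le_mul_of_nonneg_right (hM z) (abs_nonneg _)
          have hab' := abs_le.1 hab
          by_cases h1 : z ∈ E1 <;> by_cases h2 : z ∈ E2 <;> simp only [indicator, h1, h2, if_true,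
            if_false] <;> linarith [abs_nonneg (deriv (ψ j) z.2 * (η z).2)]
      _ = volume.real D * (M * ∫ t, |deriv (ψ j) t|) := by
          rw [← integral_const_mul, Measure.volume_eq_prod,
            integral_prod_mul (D.indicator (fun _ => (1:ℝ))) (fun t => M * |deriv (ψ j) t|),
            integral_indicator hD]
          simp
      _ ≤ volume.real D * (M * C0) := by
          gcongr
          exact cutf_dle k _ (hj0 j)
      _ = _ := by ring
  linarith

lemma transfer {n : ℕ} (S F F' : Set (Rn1 n)) (hS : MeasurableSet S)
    (h : ∀ z ∈ S, z ∈ F ↔ z ∈ F') (g : Rn1 n → ℝ) (hg : ∀ z, z ∉ S → g z = 0) :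
    ∫ z in F, g z = ∫ z in F', g z := by
  have h1 : S.indicator g = g := by
    ext z
    by_cases hz : z ∈ S
    · simp [hz]
    · simp [hz, hg z hz]
  have h2 : F ∩ S = F' ∩ S := by
    ext z
    constructor
    · exact fun hz => ⟨(h z hz.2).1 hz.1, hz.2⟩
    · exact fun hz => ⟨(h z hz.2).2 hz.1, hz.2⟩
  rw [← h1, setIntegral_indicator hS, setIntegral_indicator hS, h2]

lemma dotn_self {n : ℕ} (x : Rn n) : dotn x x = ‖x‖ ^ 2 := by
  rw [EuclideanSpace.norm_sq_eq, dotn]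
  refine Finset.sum_congr rfl fun i _ => ?_
  rw [Real.norm_eq_abs, sq_abs, sq]

lemma enorm1_eq {n : ℕ} (x : Rn1 n) : enorm1 x = Real.sqrt (‖x.1‖ ^ 2 + x.2 ^ 2) := by
  rw [enorm1, dotp, dotn_self, sq x.2]

lemma enorm1_fst {n : ℕ} (x : Rn1 n) : ‖x.1‖ ≤ enorm1 x := by
  rw [enorm1_eq]
  exact Real.le_sqrt_of_sq_le (by nlinarith [sq_nonneg x.2])

lemma enorm1_snd {n : ℕ} (x : Rn1 n) : |x.2| ≤ enorm1 x := by
  rw [enorm1_eq]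
  exact Real.le_sqrt_of_sq_le (by rw [sq_abs]; nlinarith [sq_nonneg ‖x.1‖])

lemma enorm1_smul {n : ℕ} (c : ℝ) (x : Rn1 n) : enorm1 (c • x) = |c| * enorm1 x := by
  rw [enorm1_eq, enorm1_eq, ← Real.sqrt_sq_eq_abs, ← Real.sqrt_mul (sq_nonneg c)]
  congr 1
  simp only [Prod.smul_fst, Prod.smul_snd, norm_smul, smul_eq_mul, mul_pow, Real.norm_eq_abs,
    sq_abs]
  ring

/-- the properties of a norm that are used -/
def NormLike {n : ℕ} (Φ : Rn1 n → ℝ) (c : ℝ) : Prop :=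
  0 < c ∧ (∀ (a : ℝ) (ξ : Rn1 n), Φ (a • ξ) = |a| * Φ ξ) ∧ ∀ ξ, c * enorm1 ξ ≤ Φ ξ

lemma enorm1_nl {n : ℕ} : NormLike (enorm1 (n := n)) 1 :=
  ⟨one_pos, enorm1_smul, fun ξ => by rw [one_mul]⟩

lemma nl_neg {n : ℕ} {Φ : Rn1 n → ℝ} {c : ℝ} (h : NormLike Φ c) (x : Rn1 n) : Φ (-x) = Φ x := by
  have := h.2.1 (-1) x
  simpa using this

lemma nl_zero {n : ℕ} {Φ : Rn1 n → ℝ} {c : ℝ} (h : NormLike Φ c) : Φ 0 = 0 := by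
  have := h.2.1 0 0
  simpa using this

lemma nl_nonneg {n : ℕ} {Φ : Rn1 n → ℝ} {c : ℝ} (h : NormLike Φ c) (x : Rn1 n) : 0 ≤ Φ x :=
  le_trans (mul_nonneg h.1.le (Real.sqrt_nonneg _)) (h.2.2 x)

lemma nl_smul_le {n : ℕ} {Φ : Rn1 n → ℝ} {c : ℝ} (h : NormLike Φ c) {x : Rn1 n} (hx : Φ x ≤ 1)
    {a : ℝ} (h0 : 0 ≤ a) (h1 : a ≤ 1) : Φ (a • x) ≤ 1 := by
  rw [h.2.1, abs_of_nonneg h0]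
  exact mul_le_one₀ h1 (nl_nonneg h x) hx

lemma nl_snd {n : ℕ} {Φ : Rn1 n → ℝ} {c : ℝ} (h : NormLike Φ c) {x : Rn1 n} (hx : Φ x ≤ 1) :
    |x.2| ≤ 1 / c := by
  rw [le_div_iff₀ h.1, mul_comm]
  exact (mul_le_mul_of_nonneg_left (enorm1_snd x) h.1.le).trans ((h.2.2 x).trans hx)

lemma divN_csmul {n : ℕ} {η : Rn n → Rn n} (hη : ContDiff ℝ 1 η) (c : ℝ) (x : Rn n) :
    divN (fun y => c • η y) x = c * divN η x := by
  unfold divN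
  rw [fderiv_fun_const_smul ((hη.differentiable one_ne_zero) x)]
  simp [Finset.mul_sum]

lemma gset_bdd {n : ℕ} {Φ : Rn1 n → ℝ} {c : ℝ} (h : NormLike Φ c) {Ω A : Set (Rn n)}
    {v : Rn n → ℝ} (hv : BVlocFun Ω v) (hA : CpCtd A Ω) : BddAbove (Gset Φ A v) := by
  obtain ⟨B, hB⟩ := hv.2 A hA
  refine ⟨B / c + 1 / c * volume.real A, ?_⟩
  rintro r ⟨ζ, hζ, hc, hs, h1, rfl⟩
  have hAf : volume A < ⊤ := lt_of_le_of_lt (measure_mono subset_closure) hA.2.1.measure_lt_top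
  have hζ1C : ContDiff ℝ 1 (fun y => (ζ y).1) := by fun_prop
  have hζ1c : HasCompactSupport (fun y => (ζ y).1) :=
    hc.comp_left (g := fun p : Rn1 n => p.1) (by simp)
  have hζ2c : HasCompactSupport (fun y => (ζ y).2) :=
    hc.comp_left (g := fun p : Rn1 n => p.2) (by simp)
  have h2i : Integrable (fun x => (ζ x).2) :=
    Continuous.integrable_of_hasCompactSupport (by have := hζ.continuous; fun_prop) hζ2c
  obtain ⟨M, hM⟩ := (divN_cs hζ1c).exists_bound_of_continuous (divN_cont hζ1C)
  have hi : IntegrableOn (fun x => v x * divN (fun y => (ζ y).1) x) A :=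
    (hv.1 A hA).mul_bdd (c := M) (divN_cont hζ1C).aestronglyMeasurable
      (Eventually.of_forall fun p => hM p)
  rw [integral_add hi h2i.integrableOn]
  refine add_le_add ?_ ?_
  · rw [le_div_iff₀ h.1]
    refine hB ⟨fun y => c • (ζ y).1, ⟨by fun_prop, ?_, ?_, ?_⟩, ?_⟩
    · exact hζ1c.comp_left (g := fun p : Rn n => c • p) (by simp)
    · refine (closure_mono ?_).trans hs
      intro x hx hx0
      exact hx (by simp [hx0])
    · intro x
      change ‖c • (ζ x).1‖ ≤ 1
      rw [norm_smul, Real.norm_eq_abs, abs_of_pos h.1]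
      exact (mul_le_mul_of_nonneg_left (enorm1_fst _) h.1.le).trans ((h.2.2 _).trans (h1 x))
    · simp_rw [divN_csmul hζ1C]
      rw [← integral_mul_const]
      congr 1
      ext x
      ring
  · calc ∫ x in A, (ζ x).2 ≤ ∫ x in A, 1 / c :=
          integral_mono h2i.integrableOn (integrableOn_const hAf.ne) fun x =>
            (le_abs_self _).trans (nl_snd h (h1 x))
      _ = _ := by simp [mul_comm]

lemma pb_of {n : ℕ} {Φ : Rn1 n → ℝ} {A : Set (Rn n)} (hA : IsOpen A)
    {v : Rn n → ℝ} (hb : BddAbove (Gset Φ A v)) : PB Φ A (A.indicator v) (Gfun Φ v A) := by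
  intro ζ hζ hc hs h1
  refine le_csSup hb ⟨ζ, hζ, hc, hs, h1, ?_⟩
  rw [← integral_indicator hA.measurableSet]
  congr 1
  ext x
  by_cases hx : x ∈ A
  · simp [hx]
  · have h2 : ζ x = 0 := image_eq_zero_of_notMem_tsupport fun h => hx (hs h)
    simp [hx, h2]

lemma sg_transfer {n : ℕ} {Ω A : Set (Rn n)} (hA : IsOpen A) (hAΩ : A ⊆ Ω) (v : Rn n → ℝ)
    {η : Rn1 n → Rn1 n} (hs : tsupport η ⊆ A ×ˢ univ) :
    ∫ z in sg Ω v, div1 η z = ∫ z in sgV (A.indicator v), div1 η z := by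
  refine transfer (A ×ˢ univ) _ _ (hA.measurableSet.prod MeasurableSet.univ) ?_ _
    (fun z hz => div1_zero fun h => hz (hs h))
  intro z hz
  have h1 : z.1 ∈ A := hz.1
  change (z.1 ∈ Ω ∧ z.2 < v z.1) ↔ z.2 < A.indicator v z.1
  rw [indicator_of_mem h1]
  exact ⟨fun h => h.2, fun h => ⟨hAΩ h1, h⟩⟩

lemma ind_int {n : ℕ} {Ω A : Set (Rn n)} {v : Rn n → ℝ} (hv : BVlocFun Ω v) (hA : CpCtd A Ω) :
    Integrable (A.indicator v) :=
  (integrable_indicator_iff hA.1.measurableSet).2 (hv.1 A hA)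

lemma sg_le {n : ℕ} {Φ : Rn1 n → ℝ} {c : ℝ} (h : NormLike Φ c) {Ω A : Set (Rn n)}
    {v : Rn n → ℝ} (hv : BVlocFun Ω v) (hA : CpCtd A Ω) {η : Rn1 n → Rn1 n}
    (hη : Test1 (A ×ˢ univ) Φ η) : -∫ z in sg Ω v, div1 η z ≤ Gfun Φ v A := by
  rw [sg_transfer hA.1 (subset_closure.trans hA.2.2) v hη.2.2.1]
  exact sub_le Φ (nl_neg h) A hA.1 _ (ind_int hv hA) _ (pb_of hA.1 (gset_bdd h hv hA)) η
    hη.1 hη.2.1 hη.2.2.1 hη.2.2.2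

/-- competitor -/
def comp {n : ℕ} (Ω : Set (Rn n)) (u v : Rn n → ℝ) (k : ℝ) : Set (Rn1 n) :=
  {z | (|z.2| < k ∧ z ∈ sg Ω v) ∨ (¬ |z.2| < k ∧ z ∈ sg Ω u)}

lemma test_smul {n : ℕ} {Φ : Rn1 n → ℝ} {c : ℝ} (h : NormLike Φ c) {S : Set (Rn1 n)}
    {η : Rn1 n → Rn1 n} (hη : Test1 S Φ η) {ψ : ℝ → ℝ} (hψ : ContDiff ℝ 1 ψ)
    (h01 : ∀ t, 0 ≤ ψ t ∧ ψ t ≤ 1) : Test1 S Φ (fun z => ψ z.2 • η z) := by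
  have hη1 := hη.1
  have hsub : Function.support (fun z : Rn1 n => ψ z.2 • η z) ⊆ Function.support η := by
    intro z hz hz0
    exact hz (by simp [hz0])
  have hC : ContDiff ℝ 1 (fun z : Rn1 n => ψ z.2 • η z) := by fun_prop
  have hcs : HasCompactSupport (fun z : Rn1 n => ψ z.2 • η z) :=
    hη.2.1.mono hsub
  exact ⟨hC, hcs, (closure_mono hsub).trans hη.2.2.1,
    fun z => nl_smul_le h (hη.2.2.2 z) (h01 _).1 (h01 _).2⟩

lemma comp_le {n : ℕ} {Φ : Rn1 n → ℝ} {c : ℝ} (h : NormLike Φ c) {Ω A : Set (Rn n)}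
    {u v : Rn n → ℝ} (hu : BVlocFun Ω u) (hv : BVlocFun Ω v) (hA : CpCtd A Ω) {η : Rn1 n → Rn1 n}
    (hη : Test1 (A ×ˢ univ) Φ η) (k : ℝ) (D : Set (Rn n)) (hD : MeasurableSet D)
    (hDf : volume D < ⊤)
    (hDE : ∀ x ∈ A, ∀ t, k - 1 ≤ |t| → ¬(t < v x ↔ t < u x) → x ∈ D) (b : ℝ)
    (hb : ∀ ψ : ℝ → ℝ, ContDiff ℝ 1 ψ → (∀ t, 0 ≤ ψ t ∧ ψ t ≤ 1) → (∀ t, |t| ≤ k - 1 → ψ t = 1) →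
      -∫ z in sg Ω u, div1 (fun z => (1 - ψ z.2) • η z) z ≤ b) :
    -∫ z in comp Ω u v k, div1 η z ≤ Gfun Φ v A + b + 1 / c * C0 * volume.real D := by
  have hAΩ : A ⊆ Ω := subset_closure.trans hA.2.2
  have := cut (sgV (A.indicator v)) (sgV (A.indicator u)) (sgV_null _ (ind_int hv hA).1)
    (sgV_null _ (ind_int hu hA).1) k η hη.1 hη.2.1 (1 / c) (fun z => nl_snd h (hη.2.2.2 z))
    D hD hDf ?_ (Gfun Φ v A) b ?_ ?_
  · refine le_of_eq_of_le ?_ this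
    congr 1
    refine transfer (A ×ˢ univ) _ _ (hA.1.measurableSet.prod MeasurableSet.univ) ?_ _
      (fun z hz => div1_zero fun h => hz (hη.2.2.1 h))
    intro z hz
    have h1 : z.1 ∈ A := hz.1
    have h2 : z.1 ∈ Ω := hAΩ h1
    simp [comp, sg, sgV, h1, h2]
  · intro z hz1 hz2 hz3
    have h1 : z.1 ∈ A := (hη.2.2.1 (subset_tsupport _ hz2)).1
    refine hDE z.1 h1 z.2 hz1 ?_
    simpa [sgV, h1] using hz3
  · intro ψ hψ h01 _
    have ht := test_smul h hη hψ h01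
    have := sg_le h hv hA ht
    rwa [sg_transfer hA.1 hAΩ v ht.2.2.1] at this
  · intro ψ hψ h01 h1
    have ht := test_smul h hη (ψ := fun t => 1 - ψ t) (by fun_prop)
      (fun t => ⟨by linarith [(h01 t).2], by linarith [(h01 t).1]⟩)
    have := hb ψ hψ h01 h1
    rwa [sg_transfer hA.1 hAΩ u ht.2.2.1] at this

lemma comp_bv {n : ℕ} {Ω : Set (Rn n)} {u v : Rn n → ℝ} (hu : BVlocFun Ω u) (hv : BVlocFun Ω v)
    (k : ℝ) : BVlocSet1 (Ω ×ˢ (univ : Set ℝ)) (comp Ω u v k) := by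
  intro B hB
  set A := Prod.fst '' B with hAd
  have hcl : closure A ⊆ Prod.fst '' closure B :=
    closure_minimal (image_mono subset_closure) (hB.2.1.image continuous_fst).isClosed
  have hA : CpCtd A Ω := by
    refine ⟨isOpenMap_fst _ hB.1,
      (hB.2.1.image continuous_fst).of_isClosed_subset isClosed_closure hcl, ?_⟩
    intro x hx
    obtain ⟨z, hz, rfl⟩ := hcl hx
    exact (hB.2.2 hz).1
  have hAf : volume A < ⊤ := lt_of_le_of_lt (measure_mono subset_closure) hA.2.1.measure_lt_top
  refine ⟨Gfun enorm1 v A + Gfun enorm1 u A + 1 / 1 * C0 * volume.real A, ?_⟩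
  rintro r ⟨η, hη, rfl⟩
  have hη' : Test1 (A ×ˢ univ) enorm1 η :=
    ⟨hη.1, hη.2.1, fun z hz => ⟨⟨z, hη.2.2.1 hz, rfl⟩, trivial⟩, hη.2.2.2⟩
  refine comp_le enorm1_nl hu hv hA hη' k A hA.1.measurableSet hAf (fun x hx _ _ _ => hx) _ ?_
  intro ψ hψ h01 _
  exact sg_le enorm1_nl hu hA (test_smul enorm1_nl hη' (ψ := fun t => 1 - ψ t) (by fun_prop)
      (fun t => ⟨by linarith [(h01 t).2], by linarith [(h01 t).1]⟩))

lemma per_bdd {n : ℕ} {Φ : Rn1 n → ℝ} {c : ℝ} (h : NormLike Φ c) {O E B : Set (Rn1 n)}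
    (hE : BVlocSet1 O E) (hB : CpCtd B O) : BddAbove (perSet1 Φ E B) := by
  obtain ⟨b, hb⟩ := hE B hB
  refine ⟨b / c, ?_⟩
  rintro r ⟨η, hη, rfl⟩
  rw [le_div_iff₀ h.1]
  have hη1 := hη.1
  refine hb ⟨fun z => c • η z, ⟨by fun_prop, ?_, ?_, ?_⟩, ?_⟩
  · exact hη.2.1.comp_left (g := fun p : Rn1 n => c • p) (by simp)
  · refine (closure_mono ?_).trans hη.2.2.1
    intro x hx hx0
    exact hx (by simp [hx0])
  · intro z
    rw [enorm1_smul, abs_of_pos h.1]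
    exact (h.2.2 _).trans (hη.2.2.2 z)
  · have : ∀ z, div1 (fun z => c • η z) z = c * div1 η z := fun z => by
      have := div1_smul hη.1 (ψ := fun _ => c) contDiff_const z
      simpa using this
    simp_rw [this]
    rw [integral_const_mul]
    ring

/-- truncated vertical extension of a field -/
noncomputable def ext1 {n : ℕ} (ζ : Rn n → Rn1 n) (m : ℝ) (z : Rn1 n) : Rn1 n :=
  (-cutf m 1 z.2) • ζ z.1

lemma ext1_C {n : ℕ} {ζ : Rn n → Rn1 n} (hζ : ContDiff ℝ 1 ζ) (m : ℝ) :
    ContDiff ℝ 1 (ext1 ζ m) := by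
  have := cutf_C m 1
  unfold ext1
  fun_prop

lemma ext1_supp {n : ℕ} (ζ : Rn n → Rn1 n) (m : ℝ) :
    tsupport (ext1 ζ m) ⊆ tsupport ζ ×ˢ Icc (-m) m := by
  refine closure_minimal ?_ ((isClosed_tsupport ζ).prod isClosed_Icc)
  intro z hz
  refine ⟨subset_tsupport _ fun h => hz (by simp [ext1, h]), abs_le.1 ?_⟩
  by_contra h
  exact hz (by simp [ext1, cutf_zero (not_le.1 h).le zero_le_one])

lemma ext1_cs {n : ℕ} {ζ : Rn n → Rn1 n} (hc : HasCompactSupport ζ) (m : ℝ) :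
    HasCompactSupport (ext1 ζ m) :=
  (hc.isCompact.prod isCompact_Icc).of_isClosed_subset (isClosed_tsupport _) (ext1_supp ζ m)

lemma div1_fst {n : ℕ} {ζ : Rn n → Rn1 n} (hζ : ContDiff ℝ 1 ζ) (z : Rn1 n) :
    div1 (fun z : Rn1 n => ζ z.1) z = divN (fun y => (ζ y).1) z.1 := by
  have h1 : HasFDerivAt ζ (fderiv ℝ ζ z.1) z.1 :=
    ((hζ.differentiable one_ne_zero) z.1).hasFDerivAt
  have h2 : HasFDerivAt (fun z : Rn1 n => ζ z.1) _ z := h1.comp z (hasFDerivAt_fst (𝕜 := ℝ))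
  have h3 : HasFDerivAt (fun y => (ζ y).1) _ z.1 := (hasFDerivAt_fst (𝕜 := ℝ)).comp z.1 h1
  unfold div1 divN
  rw [h2.fderiv, h3.fderiv]
  simp

lemma int_divN_zero {n : ℕ} {η : Rn n → Rn n} (hη : ContDiff ℝ 1 η) (hc : HasCompactSupport η) :
    ∫ x, divN η x = 0 := by
  simp_rw [divN_eq hη]
  have hC : ∀ i, ContDiff ℝ 1 (fun y => η y i) := fun i => by fun_prop
  have hcs : ∀ i, HasCompactSupport (fun y => η y i) := fun i =>
    hc.comp_left (g := fun p : Rn n => p i) (by simp)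
  rw [integral_finsetSum]
  · exact Finset.sum_eq_zero fun i _ => int_fderiv_zero _ (hC i) (hcs i) _
  · intro i _
    exact (((hC i).continuous_fderiv one_ne_zero).clm_apply
      continuous_const).integrable_of_hasCompactSupport ((hcs i).fderiv_apply (𝕜 := ℝ) _)

lemma approx_eq {n : ℕ} {V : Rn n → ℝ} (hV : Integrable V) {ζ : Rn n → Rn1 n}
    (hζ : ContDiff ℝ 1 ζ) (hc : HasCompactSupport ζ) (m : ℝ) :
    Integrable (fun x => (∫ t in (0:ℝ)..V x, cutf m 1 t) * divN (fun y => (ζ y).1) x +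
      cutf m 1 (V x) * (ζ x).2) ∧
    -∫ z in sgV V, div1 (ext1 ζ m) z =
      ∫ x, ((∫ t in (0:ℝ)..V x, cutf m 1 t) * divN (fun y => (ζ y).1) x +
      cutf m 1 (V x) * (ζ x).2) := by
  set d := divN (fun y => (ζ y).1) with hd
  have hζ1C : ContDiff ℝ 1 (fun y => (ζ y).1) := by fun_prop
  have hζ1c : HasCompactSupport (fun y => (ζ y).1) :=
    hc.comp_left (g := fun p : Rn1 n => p.1) (by simp)
  have hdi : Integrable d := (divN_cont hζ1C).integrable_of_hasCompactSupport (divN_cs hζ1c)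
  have hχi : Integrable (cutf m 1) :=
    (cutf_C m 1).continuous.integrable_of_hasCompactSupport (cutf_cs m 1 zero_le_one)
  have hχd : Integrable (deriv (cutf m 1)) :=
    ((cutf_C m 1).continuous_deriv le_rfl).integrable_of_hasCompactSupport
      (cutf_cs m 1 zero_le_one).deriv
  obtain ⟨f1, f2⟩ := fub V hV.1 (div1 (ext1 ζ m)) (div1_int (ext1_C hζ m) (ext1_cs hc m))
  have hdiv : ∀ x t, div1 (ext1 ζ m) (x, t) = -(cutf m 1 t * d x + deriv (cutf m 1) t * (ζ x).2) := by
    intro x t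
    have h1 := div1_smul (η := fun z : Rn1 n => ζ z.1) (by fun_prop) (ψ := fun t => -cutf m 1 t)
      (cutf_C m 1).neg (x, t)
    rw [div1_fst hζ] at h1
    have h2 : deriv (fun t => -cutf m 1 t) t = -deriv (cutf m 1) t := deriv.fun_neg
    simp only [h2] at h1
    change div1 (fun z : Rn1 n => (-cutf m 1 z.2) • ζ z.1) (x, t) = _
    rw [h1]
    ring
  have hin : ∀ x, ∫ t in Iic (V x), div1 (ext1 ζ m) (x, t) =
      -((∫ t in Iic (V x), cutf m 1 t) * d x + cutf m 1 (V x) * (ζ x).2) := by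
    intro x
    simp_rw [hdiv]
    rw [integral_neg, integral_add (hχi.integrableOn.mul_const _) (hχd.integrableOn.mul_const _),
      integral_mul_const, integral_mul_const,
      HasCompactSupport.integral_Iic_deriv_eq (cutf_C m 1) (cutf_cs m 1 zero_le_one)]
  have hkey : ∀ x, (∫ t in (0:ℝ)..V x, cutf m 1 t) * d x + cutf m 1 (V x) * (ζ x).2 =
      -(∫ t in Iic (V x), div1 (ext1 ζ m) (x, t)) - (∫ t in Iic (0:ℝ), cutf m 1 t) * d x := by
    intro x
    rw [hin, ← intervalIntegral.integral_Iic_sub_Iic hχi.integrableOn hχi.integrableOn]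
    ring
  simp_rw [hkey]
  refine ⟨f1.neg.sub (hdi.const_mul _), ?_⟩
  have h0 : ∫ x, d x = 0 := int_divN_zero hζ1C hζ1c
  have f1n : Integrable (fun x => -∫ t in Iic (V x), div1 (ext1 ζ m) (x, t)) := f1.neg
  rw [integral_sub f1n (hdi.const_mul _), integral_const_mul, h0, mul_zero, sub_zero,
    integral_neg, f2]

lemma approx {n : ℕ} {V : Rn n → ℝ} (hV : Integrable V) {ζ : Rn n → Rn1 n}
    (hζ : ContDiff ℝ 1 ζ) (hc : HasCompactSupport ζ) :
    Tendsto (fun m : ℕ => -∫ z in sgV V, div1 (ext1 ζ m) z) atTop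
      (nhds (∫ x, (V x * divN (fun y => (ζ y).1) x + (ζ x).2))) := by
  have hζ1C : ContDiff ℝ 1 (fun y => (ζ y).1) := by fun_prop
  have hζ1c : HasCompactSupport (fun y => (ζ y).1) :=
    hc.comp_left (g := fun p : Rn1 n => p.1) (by simp)
  have hζ2c : HasCompactSupport (fun y => (ζ y).2) :=
    hc.comp_left (g := fun p : Rn1 n => p.2) (by simp)
  have h2i : Integrable (fun x => (ζ x).2) :=
    Continuous.integrable_of_hasCompactSupport (by have := hζ.continuous; fun_prop) hζ2c
  obtain ⟨M, hM⟩ := (divN_cs hζ1c).exists_bound_of_continuous (divN_cont hζ1C)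
  have hi : Integrable (fun x => V x * divN (fun y => (ζ y).1) x) :=
    hV.mul_bdd (c := M) (divN_cont hζ1C).aestronglyMeasurable
      (Eventually.of_forall fun p => hM p)
  simp_rw [fun m : ℕ => (approx_eq hV hζ hc (m : ℝ)).2]
  refine tendsto_integral_of_dominated_convergence
    (fun x => ‖V x * divN (fun y => (ζ y).1) x‖ + ‖(ζ x).2‖)
    (fun m => (approx_eq hV hζ hc (m : ℝ)).1.1) (hi.norm.add h2i.norm) ?_ ?_
  · intro m
    refine Eventually.of_forall fun x => (norm_add_le _ _).trans (add_le_add ?_ ?_)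
    · rw [norm_mul, norm_mul]
      refine mul_le_mul_of_nonneg_right ?_ (norm_nonneg _)
      have := intervalIntegral.norm_integral_le_of_norm_le_const (a := (0:ℝ)) (b := V x)
        (f := cutf m 1) (C := 1) (fun t _ => by
          rw [Real.norm_eq_abs, abs_of_nonneg (cutf_nonneg _ _ _)]; exact cutf_le _ _ _)
      simpa using this
    · rw [norm_mul, Real.norm_eq_abs, abs_of_nonneg (cutf_nonneg _ _ _)]
      exact mul_le_of_le_one_left (norm_nonneg _) (cutf_le _ _ _)
  · refine Eventually.of_forall fun x => ?_
    obtain ⟨N, hN⟩ := exists_nat_ge (|V x| + 1)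
    refine tendsto_const_nhds.congr' ?_
    filter_upwards [eventually_ge_atTop N] with m hm
    have hm' : |V x| + 1 ≤ m := hN.trans (by exact_mod_cast hm)
    have hone : ∀ t, |t| ≤ |V x| → cutf m 1 t = 1 := fun t ht =>
      cutf_one (by linarith) zero_le_one
    rw [hone _ le_rfl]
    have : ∫ t in (0:ℝ)..V x, cutf m 1 t = ∫ t in (0:ℝ)..V x, 1 := by
      refine intervalIntegral.integral_congr fun t ht => hone t ?_
      have := abs_sub_left_of_mem_uIcc ht
      simpa using this
    rw [this]
    simp

lemma per_zero {n : ℕ} {Φ : Rn1 n → ℝ} {c : ℝ} (h : NormLike Φ c) (E B : Set (Rn1 n)) :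
    (perSet1 Φ E B).Nonempty := by
  refine ⟨_, fun _ => 0, ⟨contDiff_const, HasCompactSupport.zero, ?_, fun z => ?_⟩, rfl⟩
  · have : tsupport (fun _ : Rn1 n => (0 : Rn1 n)) = ∅ := by
      rw [tsupport_eq_empty_iff]; rfl
    rw [this]
    exact empty_subset _
  · rw [nl_zero h]
    exact zero_le_one

lemma per_mono {n : ℕ} {Φ : Rn1 n → ℝ} {E B C : Set (Rn1 n)} (hBC : B ⊆ C) :
    perSet1 Φ E B ⊆ perSet1 Φ E C := by
  rintro r ⟨η, hη, rfl⟩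
  exact ⟨η, ⟨hη.1, hη.2.1, hη.2.2.1.trans hBC, hη.2.2.2⟩, rfl⟩

lemma div1_add {n : ℕ} {η ξ : Rn1 n → Rn1 n} (hη : ContDiff ℝ 1 η) (hξ : ContDiff ℝ 1 ξ)
    (z : Rn1 n) : div1 (fun z => η z + ξ z) z = div1 η z + div1 ξ z := by
  unfold div1
  rw [fderiv_fun_add ((hη.differentiable one_ne_zero) z) ((hξ.differentiable one_ne_zero) z)]
  simp [Finset.sum_add_distrib]
  ring

lemma superadd {n : ℕ} {Φ : Rn1 n → ℝ} {c : ℝ} (h : NormLike Φ c) {E B U : Set (Rn1 n)}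
    (hb : BddAbove (perSet1 Φ E B)) (hU : U ⊆ B) {η : Rn1 n → Rn1 n} (hη : Test1 B Φ η)
    (hd : ∀ z ∈ U, η z = 0) : (-∫ z in E, div1 η z) + Per1 Φ E U ≤ Per1 Φ E B := by
  have : Per1 Φ E U ≤ Per1 Φ E B - -∫ z in E, div1 η z := by
    refine csSup_le (per_zero h E U) ?_
    rintro r ⟨ξ, hξ, rfl⟩
    rw [le_sub_iff_add_le]
    have hη1 := hη.1
    have hξ1 := hξ.1
    have hs : tsupport (fun z => ξ z + η z) ⊆ tsupport ξ ∪ tsupport η := tsupport_add ξ η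
    refine le_csSup hb ⟨fun z => ξ z + η z, ⟨by fun_prop, hξ.2.1.add hη.2.1,
      hs.trans (union_subset (hξ.2.2.1.trans hU) hη.2.2.1), fun z => ?_⟩, ?_⟩
    · change Φ (ξ z + η z) ≤ 1
      by_cases hz : z ∈ U
      · rw [hd z hz, add_zero]
        exact hξ.2.2.2 z
      · have : ξ z = 0 := image_eq_zero_of_notMem_tsupport fun h => hz (hξ.2.2.1 h)
        rw [this, zero_add]
        exact hη.2.2.2 z
    · simp_rw [div1_add hξ1 hη1]
      rw [integral_add (div1_int hξ1 hξ.2.1).integrableOn (div1_int hη1 hη.2.1).integrableOn]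
      ring
  linarith

lemma step {n : ℕ} {Φ : Rn1 n → ℝ} {c : ℝ} (h : NormLike Φ c) {Ω A : Set (Rn n)}
    {u v : Rn n → ℝ} (hu : BVlocFun Ω u) (hv : BVlocFun Ω v)
    (hmin : MinPer1 Φ (Ω ×ˢ (univ : Set ℝ)) (sg Ω u)) (hA : CpCtd A Ω)
    (hsupp : CptSupp A (fun x => u x - v x)) (m : ℕ) (D : Set (Rn n)) (hD : MeasurableSet D)
    (hDf : volume D < ⊤)
    (hDE : ∀ x ∈ A, ∀ t, (m + 1 : ℝ) ≤ |t| → ¬(t < v x ↔ t < u x) → x ∈ D)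
    {η : Rn1 n → Rn1 n} (hη : Test1 (A ×ˢ Icc (-(m : ℝ)) m) Φ η) :
    -∫ z in sg Ω u, div1 η z ≤ Gfun Φ v A + 1 / c * C0 * volume.real D := by
  have hm0 : (0 : ℝ) ≤ m := Nat.cast_nonneg m
  set k : ℝ := m + 2 with hk
  set B : Set (Rn1 n) := A ×ˢ Ioo (-(k + 1)) (k + 1) with hB
  have hBc : CpCtd B (Ω ×ˢ (univ : Set ℝ)) := by
    have hcl : closure B = closure A ×ˢ Icc (-(k + 1)) (k + 1) := by
      rw [hB, closure_prod_eq, closure_Ioo (by linarith)]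
    refine ⟨hA.1.prod isOpen_Ioo, ?_, ?_⟩
    · rw [hcl]
      exact hA.2.1.prod isCompact_Icc
    · rw [hcl]
      exact prod_mono hA.2.2 (subset_univ _)
  set U : Set (Rn1 n) := B ∩ {z | (m : ℝ) < |z.2|} with hU
  have hUB : U ⊆ B := inter_subset_left
  have hbu : BddAbove (perSet1 Φ (sg Ω u) B) := per_bdd h hmin.1 hBc
  have hbU : BddAbove (perSet1 Φ (sg Ω u) U) := hbu.mono (per_mono hUB)
  have hsd : symmDiff (sg Ω u) (comp Ω u v k) ⊆ tsupport (fun x => u x - v x) ×ˢ Icc (-k) k := by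
    intro z hz
    have hzk : |z.2| < k := by
      by_contra hn
      rcases hz with hz | hz
      · exact hz.2 (Or.inr ⟨hn, hz.1⟩)
      · rcases hz.1 with h1 | h1
        · exact hn h1.1
        · exact hz.2 h1.2
    refine ⟨subset_tsupport _ fun h0 => ?_, abs_le.1 hzk.le⟩
    have h0' : u z.1 = v z.1 := sub_eq_zero.1 h0
    rcases hz with hz | hz
    · refine hz.2 (Or.inl ⟨hzk, hz.1.1, ?_⟩)
      rw [← h0']
      exact hz.1.2
    · rcases hz.1 with h1 | h1
      · refine hz.2 ⟨h1.2.1, ?_⟩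
        rw [h0']
        exact h1.2.2
      · exact h1.1 hzk
  have hKc : IsCompact (tsupport (fun x => u x - v x) ×ˢ Icc (-k) k) :=
    hsupp.1.prod isCompact_Icc
  have hsdc : closure (symmDiff (sg Ω u) (comp Ω u v k)) ⊆
      tsupport (fun x => u x - v x) ×ˢ Icc (-k) k := closure_minimal hsd hKc.isClosed
  have hle : Per1 Φ (sg Ω u) B ≤ Per1 Φ (comp Ω u v k) B := by
    refine hmin.2 B hBc _ (comp_bv hu hv k) (hKc.of_isClosed_subset isClosed_closure hsdc)
      (hsdc.trans (prod_mono hsupp.2 ?_))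
    exact Icc_subset_Ioo (by linarith) (by linarith)
  have hF : Per1 Φ (comp Ω u v k) B ≤
      Gfun Φ v A + Per1 Φ (sg Ω u) U + 1 / c * C0 * volume.real D := by
    refine csSup_le (per_zero h _ _) ?_
    rintro r ⟨ξ, hξ, rfl⟩
    have hξ' : Test1 (A ×ˢ univ) Φ ξ :=
      ⟨hξ.1, hξ.2.1, hξ.2.2.1.trans (prod_mono subset_rfl (subset_univ _)), hξ.2.2.2⟩
    refine comp_le h hu hv hA hξ' k D hD hDf (fun x hx t ht => hDE x hx t (by linarith)) _ ?_
    intro ψ hψ h01 h1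
    have ht := test_smul h hξ (ψ := fun t => 1 - ψ t) (by fun_prop)
      (fun t => ⟨by linarith [(h01 t).2], by linarith [(h01 t).1]⟩)
    refine le_csSup hbU ⟨_, ⟨ht.1, ht.2.1, subset_inter ht.2.2.1 ?_, ht.2.2.2⟩, rfl⟩
    have hcl : IsClosed {z : Rn1 n | (m : ℝ) + 1 ≤ |z.2|} :=
      isClosed_le continuous_const (by fun_prop)
    have hsub : tsupport (fun z : Rn1 n => (1 - ψ z.2) • ξ z) ⊆ {z : Rn1 n | (m : ℝ) + 1 ≤ |z.2|} := by
      refine closure_minimal ?_ hcl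
      intro z hz
      by_contra hn
      have hn' : |z.2| < (m : ℝ) + 1 := not_le.1 hn
      exact hz (by simp [h1 z.2 (by linarith)])
    intro z hz
    have : (m : ℝ) + 1 ≤ |z.2| := hsub hz
    change (m : ℝ) < |z.2|
    linarith
  have hsa := superadd h hbu hUB (η := η)
    ⟨hη.1, hη.2.1, hη.2.2.1.trans (prod_mono subset_rfl
      (Icc_subset_Ioo (by linarith) (by linarith))), hη.2.2.2⟩ ?_
  · linarith
  · intro z hz
    refine image_eq_zero_of_notMem_tsupport fun h => ?_
    have h1 : |z.2| ≤ m := abs_le.2 (hη.2.2.1 h).2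
    have h2 : (m : ℝ) < |z.2| := hz.2
    linarith

lemma badset {n : ℕ} {U V : Rn n → ℝ} (hU : Integrable U) (hV : Integrable V) :
    ∃ D : ℕ → Set (Rn n), (∀ m, MeasurableSet (D m)) ∧ (∀ m, volume (D m) < ⊤) ∧
      (∀ m : ℕ, ∀ x, ((m : ℝ) + 1 : ℝ) ≤ |U x| + |V x| → x ∈ D m) ∧
      Tendsto (fun m => volume.real (D m)) atTop (nhds 0) := by
  have hi : Integrable (fun x => |U x| + |V x|) := hU.abs.add hV.abs
  have hpos : ∀ m : ℕ, (0 : ℝ) < m + 1 := fun m => by positivity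
  have hnn : ∀ x, 0 ≤ |U x| + |V x| := fun x => by positivity
  refine ⟨fun m => toMeasurable volume {x | (m + 1 : ℝ) ≤ |U x| + |V x|},
    fun m => measurableSet_toMeasurable _ _, ?_, fun m x hx => subset_toMeasurable _ _ hx, ?_⟩
  · intro m
    rw [measure_toMeasurable]
    exact hi.measure_ge_lt_top (hpos m)
  · have hb : ∀ m : ℕ, volume.real (toMeasurable volume {x | (m + 1 : ℝ) ≤ |U x| + |V x|}) ≤
        (∫ x, (|U x| + |V x|)) * (1 / ((m : ℝ) + 1)) := by
      intro m
      rw [mul_one_div, le_div_iff₀ (hpos m), mul_comm]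
      have := mul_meas_ge_le_integral_of_nonneg (Eventually.of_forall hnn) hi ((m : ℝ) + 1)
      rw [measureReal_def, measure_toMeasurable]
      exact this
    refine squeeze_zero (fun m => measureReal_nonneg) hb ?_
    have := (tendsto_one_div_add_atTop_nhds_zero_nat (𝕜 := ℝ)).const_mul (∫ x, (|U x| + |V x|))
    simpa using this

theorem minG_of_minPer_subgraph {n : ℕ} (Φ : Rn1 n → ℝ) (hΦ : IsNorm1 Φ)
    (Ω : Set (Rn n)) (hΩ : IsOpen Ω) (u : Rn n → ℝ) (hu : BVlocFun Ω u)
    (hmin : MinPer1 Φ (Ω ×ˢ (univ : Set ℝ)) (sg Ω u)) :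
    MinG Φ Ω u := by
  obtain ⟨_, hhom, c, hc0, hlow⟩ := hΦ
  have h : NormLike Φ c := ⟨hc0, hhom, hlow⟩
  refine ⟨hu, fun A hA v hv hsupp => ?_⟩
  obtain ⟨D, hD, hDf, hDE, hDt⟩ := badset (ind_int hu hA) (ind_int hv hA)
  refine csSup_le ?_ ?_
  · refine ⟨_, fun _ => 0, contDiff_const, HasCompactSupport.zero, ?_, fun z => ?_, rfl⟩
    · have : tsupport (fun _ : Rn n => (0 : Rn1 n)) = ∅ := by
        rw [tsupport_eq_empty_iff]; rfl
      rw [this]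
      exact empty_subset _
    · rw [nl_zero h]
      exact zero_le_one
  rintro r ⟨ζ, hζ, hc, hs, h1, rfl⟩
  have heq : ∫ x in A, (u x * divN (fun y => (ζ y).1) x + (ζ x).2) =
      ∫ x, (A.indicator u x * divN (fun y => (ζ y).1) x + (ζ x).2) := by
    rw [← integral_indicator hA.1.measurableSet]
    congr 1
    ext x
    by_cases hx : x ∈ A
    · simp [hx]
    · have h2 : ζ x = 0 := image_eq_zero_of_notMem_tsupport fun h => hx (hs h)
      simp [hx, h2]
  rw [heq]
  have hR : Tendsto (fun m => Gfun Φ v A + 1 / c * C0 * volume.real (D m)) atTop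
      (nhds (Gfun Φ v A)) := by
    have := (hDt.const_mul (1 / c * C0)).const_add (Gfun Φ v A)
    simpa using this
  refine le_of_tendsto_of_tendsto' (approx (ind_int hu hA) hζ hc) hR fun m => ?_
  have hts : tsupport (ext1 ζ m) ⊆ A ×ˢ Icc (-(m : ℝ)) m :=
    (ext1_supp ζ m).trans (prod_mono hs subset_rfl)
  rw [← sg_transfer hA.1 (subset_closure.trans hA.2.2) u
    (hts.trans (prod_mono subset_rfl (subset_univ _)))]
  refine step h hu hv hmin hA hsupp m (D m) (hD m) (hDf m) ?_
    ⟨ext1_C hζ m, ext1_cs hc m, hts, fun z => ?_⟩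
  · intro x hx t ht hn
    refine hDE m x ?_
    rw [indicator_of_mem hx, indicator_of_mem hx]
    by_contra hlt
    have hlt' := not_le.1 hlt
    apply hn
    have a1 := abs_nonneg (u x)
    have a2 := abs_nonneg (v x)
    have a3 := le_abs_self (u x)
    have a4 := le_abs_self (v x)
    have a5 := neg_abs_le (u x)
    have a6 := neg_abs_le (v x)
    rcases le_abs.1 ht with ht | ht
    · constructor <;> intro h0 <;> linarith
    · constructor <;> intro h0 <;> linarith
  · unfold ext1
    rw [neg_smul, nl_neg h]
    exact nl_smul_le h (h1 _) (cutf_nonneg _ _ _) (cutf_le _ _ _)
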